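/- arXiv:2110.00734 — 10 statements merged into one kernel-verified Lean document; each statement's English description precedes it below -/
import Mathlib

section
/- For every instance Γ = ⟨S, C, ≻, q⟩ and any choice of penalties r_{s,∅}, consider the integer program: minimize Σ_{(s,c)∈E} r_{s,c}·x_{s,c} over x ∈ {0,1}^E subject to Σ_{c:(s,c)∈E} x_{s,c} = 1 for all s ∈ S; Σ_{s:(s,c)∈E} x_{s,c} ≤ q_c for all c ∈ C; and q_c·x_{s,c} + q_c·Σ_{c'≻_s c} x_{s,c'} + Σ_{s'≻_c s} x_{s',c} ≥ q_c for all (s,c) ∈ E with c ∈ C. Then the indicator vector of a matching μ (x_{s,c} = 1 iff μ(s) = c, for c ∈ C ∪ {∅}) is an optimal solution of this integer program if and only if μ is the student-optimal stable matching of Γ. -/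
open scoped BigOperators

/-- An instance of the school choice problem: capacities, acceptability (feasible pairs),
strict student preferences over acceptable schools, and strict school priorities over
acceptable students. -/
structure SchoolInstance (S C : Type*) where
  /-- capacity of each school -/
  q : C → ℕ
  /-- `acc s c` means `(s,c) ∈ E`, i.e. school `c` is acceptable to student `s` -/
  acc : S → C → Prop
  /-- `sPref s c c'` means `c ≻_s c'` -/
  sPref : S → C → C → Prop
  /-- `cPref c s s'` means `s ≻_c s'` -/
  cPref : C → S → S → Prop
  sPref_irrefl : ∀ s c, ¬ sPref s c c
  sPref_trans : ∀ s c₁ c₂ c₃, sPref s c₁ c₂ → sPref s c₂ c₃ → sPref s c₁ c₃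
  sPref_total : ∀ s c₁ c₂, acc s c₁ → acc s c₂ → c₁ ≠ c₂ → sPref s c₁ c₂ ∨ sPref s c₂ c₁
  sPref_acc : ∀ s c₁ c₂, sPref s c₁ c₂ → acc s c₁ ∧ acc s c₂
  cPref_irrefl : ∀ c s, ¬ cPref c s s
  cPref_trans : ∀ c s₁ s₂ s₃, cPref c s₁ s₂ → cPref c s₂ s₃ → cPref c s₁ s₃
  cPref_total : ∀ c s₁ s₂, acc s₁ c → acc s₂ c → s₁ ≠ s₂ → cPref c s₁ s₂ ∨ cPref c s₂ s₁
  cPref_acc : ∀ c s₁ s₂, cPref c s₁ s₂ → acc s₁ c ∧ acc s₂ c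

namespace SchoolInstance

variable {S C : Type*} [Fintype S] [Fintype C]

/-- The expanded instance `Γ_t = ⟨S, C, ≻, q + t⟩`. -/
def expand (i : SchoolInstance S C) (t : C → ℕ) : SchoolInstance S C :=
  { i with q := fun c => i.q c + t c }

/-- Students assigned to school `c` under assignment `μ`. -/
def assignedSet (μ : S → Option C) (c : C) : Set S := {s | μ s = some c}

/-- `μ` is a matching: assignments are feasible pairs and capacities are respected. -/
def IsMatching (i : SchoolInstance S C) (μ : S → Option C) : Prop :=
  (∀ s c, μ s = some c → i.acc s c) ∧ ∀ c, (assignedSet μ c).ncard ≤ i.q c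

/-- Student `s` strictly prefers school `c` to the (possibly empty) assignment `o`. -/
def prefOver (i : SchoolInstance S C) (s : S) (c : C) : Option C → Prop
  | none => i.acc s c
  | some c' => i.sPref s c c'

/-- `(s,c)` is a blocking pair for `μ`. -/
def IsBlocking (i : SchoolInstance S C) (μ : S → Option C) (s : S) (c : C) : Prop :=
  i.acc s c ∧ i.prefOver s c (μ s) ∧
    ((assignedSet μ c).ncard < i.q c ∨ ∃ s', μ s' = some c ∧ i.cPref c s s')

/-- `μ` is a stable matching. -/
def IsStable (i : SchoolInstance S C) (μ : S → Option C) : Prop :=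
  i.IsMatching μ ∧ ∀ s c, ¬ i.IsBlocking μ s c

/-- Student `s` weakly prefers assignment `o` to assignment `o'`. -/
def weakPref (i : SchoolInstance S C) (s : S) (o o' : Option C) : Prop :=
  o = o' ∨ ∃ c, o = some c ∧ i.prefOver s c o'

/-- `μ` is the student-optimal stable matching: it is stable and every student weakly
prefers it to any other stable matching. -/
def IsStudentOptimal (i : SchoolInstance S C) (μ : S → Option C) : Prop :=
  i.IsStable μ ∧ ∀ μ', i.IsStable μ' → ∀ s, i.weakPref s (μ s) (μ' s)

/-- `rank i s c` is the rank `r_{s,c}` of school `c` in `≻_s` (1 = most preferred). -/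
noncomputable def rank (i : SchoolInstance S C) (s : S) (c : C) : ℕ :=
  1 + {c' | i.sPref s c' c}.ncard

end SchoolInstance

namespace SchoolInstance

variable {S C : Type*} [Fintype S] [Fintype C]

/-- The objective `Σ_{(s,c)∈E} r_{s,c}·x_{s,c}` (the feasible pairs `E` include `(s,∅)`). -/
noncomputable def objX (i : SchoolInstance S C) (r : S → Option C → ℝ)
    (x : S → Option C → ℝ) : ℝ :=
  ∑ s, (r s none * x s none + ∑ᶠ c ∈ {c | i.acc s c}, r s (some c) * x s (some c))

/-- Feasibility for the integer program of Formulation (1): `x ∈ {0,1}^E`,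
each student fully assigned, capacities respected, and the stability constraints. -/
def ipFeasible (i : SchoolInstance S C) (x : S → Option C → ℝ) : Prop :=
  (∀ s c, ¬ i.acc s c → x s (some c) = 0) ∧
  (∀ s o, x s o = 0 ∨ x s o = 1) ∧
  (∀ s, x s none + ∑ᶠ c ∈ {c | i.acc s c}, x s (some c) = 1) ∧
  (∀ c, ∑ᶠ s ∈ {s | i.acc s c}, x s (some c) ≤ (i.q c : ℝ)) ∧
  (∀ s c, i.acc s c →
    (i.q c : ℝ) ≤ (i.q c : ℝ) * x s (some c)
      + (i.q c : ℝ) * (∑ᶠ c' ∈ {c' | i.sPref s c' c}, x s (some c'))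
      + ∑ᶠ s' ∈ {s' | i.cPref c s' s}, x s' (some c))

end SchoolInstance

open SchoolInstance

namespace SchoolInstance

theorem finsum_mem_eq_sum_ite {α M : Type*} [Fintype α] [AddCommMonoid M] (A : Set α)
    [DecidablePred (· ∈ A)] (f : α → M) :
    ∑ᶠ a ∈ A, f a = ∑ a, if a ∈ A then f a else 0 := by
  rw [finsum_mem_def, finsum_eq_sum_of_fintype]
  exact Finset.sum_congr rfl fun a _ => Set.indicator_apply A f a

theorem ncard_eq_sum_ite {α : Type*} [Fintype α] (A : Set α) [DecidablePred (· ∈ A)] :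
    A.ncard = ∑ a, if a ∈ A then 1 else 0 := by
  rw [Set.ncard_eq_toFinset_card', Finset.sum_boole]
  simp [Set.toFinset]

theorem sum_ncard_fiber {S C : Type*} [Fintype S] [Fintype C] (P : Set S) (μ : S → Option C) :
    ∑ c, (P ∩ assignedSet μ c).ncard = {s | s ∈ P ∧ μ s ≠ none}.ncard := by
  classical
  simp only [ncard_eq_sum_ite]
  rw [Finset.sum_comm]
  refine Finset.sum_congr rfl fun s _ => ?_
  obtain h | ⟨c, h⟩ := Option.eq_none_or_eq_some (μ s) <;>
    by_cases hs : s ∈ P <;> simp [assignedSet, hs, h]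

section Preferences

variable {S C : Type*} {i : SchoolInstance S C}

/-- Student `s` strictly prefers the assignment `o` to the assignment `o'`. -/
def strictPref (i : SchoolInstance S C) (s : S) (o o' : Option C) : Prop :=
  ∃ c, o = some c ∧ i.prefOver s c o'

theorem prefOver_trans {s : S} {c c' : C} {o : Option C} (h : i.sPref s c c')
    (h' : i.prefOver s c' o) : i.prefOver s c o := by
  cases o with
  | none => exact (i.sPref_acc s c c' h).1
  | some d => exact i.sPref_trans s c c' d h h'

theorem prefOver_of_prefOver_of_weakPref {s : S} {c : C} {o o' : Option C}
    (h : i.prefOver s c o) (h' : i.weakPref s o o') : i.prefOver s c o' := by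
  rcases h' with rfl | ⟨d, rfl, hd⟩
  · exact h
  · exact prefOver_trans h hd

theorem eq_or_strictPref_or_strictPref {s : S} {o o' : Option C}
    (h : ∀ c, o = some c → i.acc s c) (h' : ∀ c, o' = some c → i.acc s c) :
    o = o' ∨ i.strictPref s o o' ∨ i.strictPref s o' o := by
  cases o with
  | none =>
    cases o' with
    | none => exact Or.inl rfl
    | some d => exact Or.inr (Or.inr ⟨d, rfl, h' d rfl⟩)
  | some c =>
    cases o' with
    | none => exact Or.inr (Or.inl ⟨c, rfl, h c rfl⟩)
    | some d =>
      by_cases hcd : c = d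
      · exact Or.inl (congrArg some hcd)
      · rcases i.sPref_total s c d (h c rfl) (h' d rfl) hcd with hp | hp
        · exact Or.inr (Or.inl ⟨c, rfl, hp⟩)
        · exact Or.inr (Or.inr ⟨d, rfl, hp⟩)

theorem rank_lt_rank [Finite C] {s : S} {c c' : C} (h : i.sPref s c c') :
    i.rank s c < i.rank s c' := by
  refine Nat.add_lt_add_left (Set.ncard_lt_ncard ?_ (Set.toFinite _)) 1
  refine Set.ssubset_iff_of_subset (fun d hd => i.sPref_trans s d c c' hd h) |>.2 ?_
  exact ⟨c, h, i.sPref_irrefl s c⟩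

theorem prefOver_iff {μ : S → Option C} {s : S} {c : C}
    (hμ : ∀ d, μ s = some d → i.acc s d) (ha : i.acc s c) :
    i.prefOver s c (μ s) ↔ μ s ≠ some c ∧ ∀ d, i.sPref s d c → μ s ≠ some d := by
  cases hs : μ s with
  | none => simp [prefOver, ha]
  | some e =>
    simp only [prefOver, ne_eq, Option.some.injEq]
    constructor
    · intro h
      refine ⟨?_, ?_⟩
      · rintro rfl
        exact i.sPref_irrefl _ _ h
      · rintro d hd rfl
        exact i.sPref_irrefl _ _ (i.sPref_trans _ _ _ _ h hd)
    · rintro ⟨h1, h2⟩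
      exact (i.sPref_total s c e ha (hμ e hs) (Ne.symm h1)).resolve_right fun h => h2 e h rfl

theorem lt_of_strictPref [Finite C] {r : S → Option C → ℝ}
    (hr : ∀ s c, i.acc s c → r s (some c) = (i.rank s c : ℝ)) {s : S} {o o' : Option C}
    (ho : o' ≠ none) (h : i.strictPref s o o') : r s o < r s o' := by
  obtain ⟨c, rfl, h⟩ := h
  obtain ⟨d, rfl⟩ := Option.ne_none_iff_exists'.1 ho
  have hacc := i.sPref_acc s c d h
  rw [hr s c hacc.1, hr s d hacc.2, Nat.cast_lt]
  exact rank_lt_rank h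

end Preferences

section Join

variable {S C : Type*} {i : SchoolInstance S C} {μ ν : S → Option C}

open Classical in
/-- Every student gets the better of their assignments under `μ` and `ν`. -/
noncomputable def join (i : SchoolInstance S C) (μ ν : S → Option C) (s : S) : Option C :=
  if i.strictPref s (μ s) (ν s) then μ s else ν s

/-- The students strictly preferring their assignment under `μ` to the one under `ν`. -/
def prefSet (i : SchoolInstance S C) (μ ν : S → Option C) : Set S :=
  {s | i.strictPref s (μ s) (ν s)}

theorem weakPref_join_left (hμ : i.IsMatching μ) (hν : i.IsMatching ν) (s : S) :
    i.weakPref s (i.join μ ν s) (μ s) := by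
  unfold join
  split_ifs with h
  · exact Or.inl rfl
  · rcases eq_or_strictPref_or_strictPref (hμ.1 s) (hν.1 s) with h' | h' | h'
    · exact Or.inl h'.symm
    · exact absurd h' h
    · exact Or.inr h'

theorem weakPref_join_right (s : S) : i.weakPref s (i.join μ ν s) (ν s) := by
  unfold join
  split_ifs with h
  · exact Or.inr h
  · exact Or.inl rfl

theorem IsStable.full (hμ : i.IsStable μ) {s : S} {c : C} (hs : i.prefOver s c (μ s))
    (ha : i.acc s c) : (assignedSet μ c).ncard = i.q c :=
  le_antisymm (hμ.1.2 c) (not_lt.1 fun h => hμ.2 s c ⟨ha, hs, Or.inl h⟩)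

theorem IsStable.cPref (hμ : i.IsStable μ) {s t : S} {c : C} (hs : i.prefOver s c (μ s))
    (ha : i.acc s c) (ht : μ t = some c) : i.cPref c t s := by
  have hne : t ≠ s := by
    rintro rfl
    rw [ht] at hs
    exact i.sPref_irrefl t c hs
  exact (i.cPref_total c t s (hμ.1.1 t c ht) ha hne).resolve_right
    fun h => hμ.2 s c ⟨ha, hs, Or.inr ⟨t, ht, h⟩⟩

theorem ncard_prefSet_inter_le [Finite S] (hμ : i.IsStable μ) (hν : i.IsStable ν) (c : C) :
    (i.prefSet μ ν ∩ assignedSet μ c).ncard ≤ (i.prefSet μ ν ∩ assignedSet ν c).ncard := by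
  rcases (i.prefSet μ ν ∩ assignedSet μ c).eq_empty_or_nonempty with h0 | ⟨s, hs, hsc⟩
  · simp [h0]
  have hsc' : μ s = some c := hsc
  have ha := hμ.1.1 s c hsc'
  have hp : i.prefOver s c (ν s) := by
    obtain ⟨d, hd, hp⟩ := hs
    rw [hsc'] at hd
    cases hd
    exact hp
  have hsub : assignedSet ν c \ i.prefSet μ ν ⊆ assignedSet μ c \ i.prefSet μ ν := by
    rintro t ⟨ht, htP⟩
    refine ⟨?_, htP⟩
    have ht' : ν t = some c := ht
    rcases eq_or_strictPref_or_strictPref (hμ.1.1 t) (hν.1.1 t) with h | h | h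
    · exact h.trans ht'
    · exact absurd h htP
    · obtain ⟨d, hd, h⟩ := h
      rw [ht'] at hd
      cases hd
      exact absurd ⟨hν.1.1 t c ht', h, Or.inr ⟨s, hsc', hν.cPref hp ha ht'⟩⟩ (hμ.2 t c)
  have h1 := Set.ncard_le_ncard hsub (Set.toFinite _)
  have h2 := Set.ncard_inter_add_ncard_sdiff_eq_ncard (assignedSet μ c) (i.prefSet μ ν)
    (Set.toFinite _)
  have h3 := Set.ncard_inter_add_ncard_sdiff_eq_ncard (assignedSet ν c) (i.prefSet μ ν)
    (Set.toFinite _)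
  have h4 := hν.full hp ha
  have h5 := hμ.1.2 c
  rw [Set.inter_comm _ (assignedSet μ c), Set.inter_comm _ (assignedSet ν c)]
  omega

variable [Fintype S] [Fintype C]

theorem sum_ncard_prefSet_inter_left :
    ∑ c, (i.prefSet μ ν ∩ assignedSet μ c).ncard = (i.prefSet μ ν).ncard := by
  rw [sum_ncard_fiber]
  congr 1
  ext s
  refine ⟨And.left, fun h => ⟨h, ?_⟩⟩
  obtain ⟨c, hc, -⟩ := h
  simp [hc]

theorem ncard_prefSet_inter_eq (hμ : i.IsStable μ) (hν : i.IsStable ν) (c : C) :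
    (i.prefSet μ ν ∩ assignedSet μ c).ncard = (i.prefSet μ ν ∩ assignedSet ν c).ncard := by
  have hle := fun c (_ : c ∈ Finset.univ) => ncard_prefSet_inter_le hμ hν c
  refine (Finset.sum_eq_sum_iff_of_le hle).1 ((Finset.sum_le_sum hle).antisymm ?_) c
    (Finset.mem_univ c)
  rw [sum_ncard_prefSet_inter_left, sum_ncard_fiber]
  exact Set.ncard_le_ncard (fun s hs => hs.1) (Set.toFinite _)

/-- One half of the rural hospitals theorem. -/
theorem IsStable.ne_none (hμ : i.IsStable μ) (hν : i.IsStable ν) {s : S} (hs : μ s ≠ none) :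
    ν s ≠ none := by
  intro hn
  obtain ⟨c, hc⟩ := Option.ne_none_iff_exists'.1 hs
  have hP : s ∈ i.prefSet μ ν := ⟨c, hc, by rw [hn]; exact hμ.1.1 s c hc⟩
  have heq : {s | s ∈ i.prefSet μ ν ∧ ν s ≠ none} = i.prefSet μ ν := by
    refine Set.eq_of_subset_of_ncard_le (fun s hs => hs.1) ?_ (Set.toFinite _)
    rw [← sum_ncard_fiber, ← sum_ncard_prefSet_inter_left]
    exact Finset.sum_le_sum fun c _ => ncard_prefSet_inter_le hμ hν c
  rw [← heq] at hP
  exact hP.2 hn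

theorem ncard_assignedSet_join (hμ : i.IsStable μ) (hν : i.IsStable ν) (c : C) :
    (assignedSet (i.join μ ν) c).ncard = (assignedSet ν c).ncard := by
  have h1 : assignedSet (i.join μ ν) c ∩ i.prefSet μ ν = i.prefSet μ ν ∩ assignedSet μ c := by
    ext s
    simp only [assignedSet, prefSet, join, Set.mem_inter_iff, Set.mem_ofPred_eq]
    split_ifs with h <;> simp [h]
  have h2 : assignedSet (i.join μ ν) c \ i.prefSet μ ν = assignedSet ν c \ i.prefSet μ ν := by
    ext s
    simp only [assignedSet, prefSet, join, Set.mem_sdiff, Set.mem_ofPred_eq]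
    split_ifs with h <;> simp [h]
  rw [← Set.ncard_inter_add_ncard_sdiff_eq_ncard _ (i.prefSet μ ν) (Set.toFinite _), h1, h2,
    ncard_prefSet_inter_eq hμ hν, Set.inter_comm,
    Set.ncard_inter_add_ncard_sdiff_eq_ncard _ _ (Set.toFinite _)]

theorem IsStable.join (hμ : i.IsStable μ) (hν : i.IsStable ν) : i.IsStable (i.join μ ν) := by
  have hcases : ∀ s, i.join μ ν s = μ s ∨ i.join μ ν s = ν s := by
    intro s
    unfold SchoolInstance.join
    split_ifs <;> simp
  refine ⟨⟨fun s c h => ?_, fun c => ?_⟩, ?_⟩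
  · rcases hcases s with h' | h'
    · exact hμ.1.1 s c (h'.symm.trans h)
    · exact hν.1.1 s c (h'.symm.trans h)
  · exact (ncard_assignedSet_join hμ hν c).trans_le (hν.1.2 c)
  · rintro s c ⟨ha, hp, hb⟩
    have hpμ := prefOver_of_prefOver_of_weakPref hp (weakPref_join_left hμ.1 hν.1 s)
    have hpν := prefOver_of_prefOver_of_weakPref hp (weakPref_join_right s)
    rcases hb with hb | ⟨t, ht, hst⟩
    · rw [ncard_assignedSet_join hμ hν] at hb
      exact hν.2 s c ⟨ha, hpν, Or.inl hb⟩
    · rcases hcases t with h' | h'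
      · exact hμ.2 s c ⟨ha, hpμ, Or.inr ⟨t, h'.symm.trans ht, hst⟩⟩
      · exact hν.2 s c ⟨ha, hpν, Or.inr ⟨t, h'.symm.trans ht, hst⟩⟩

theorem le_of_weakPref {r : S → Option C → ℝ}
    (hr : ∀ s c, i.acc s c → r s (some c) = (i.rank s c : ℝ))
    (hμ : i.IsStable μ) (hν : i.IsStable ν) {s : S} (h : i.weakPref s (μ s) (ν s)) :
    r s (μ s) ≤ r s (ν s) := by
  rcases h with h | h
  · rw [h]
  · refine (lt_of_strictPref hr (hμ.ne_none hν ?_) h).le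
    obtain ⟨c, hc, -⟩ := h
    simp [hc]

end Join

section IntegerProgram

variable {S C : Type*} [DecidableEq C] {i : SchoolInstance S C} {μ : S → Option C}

/-- The indicator vector of an assignment. -/
def indicatorVec (μ : S → Option C) (s : S) (o : Option C) : ℝ := if μ s = o then 1 else 0

theorem finsum_mem_indicatorVec_school [Fintype C] (A : Set C) (g : C → ℝ)
    (μ : S → Option C) (s : S) :
    (∀ c, μ s = some c → c ∈ A → ∑ᶠ c ∈ A, g c * indicatorVec μ s (some c) = g c) ∧
    ((∀ c ∈ A, μ s ≠ some c) → ∑ᶠ c ∈ A, g c * indicatorVec μ s (some c) = 0) := by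
  classical
  rw [finsum_mem_eq_sum_ite]
  constructor
  · intro c hc hA
    rw [Finset.sum_eq_single c]
    · simp [indicatorVec, hc, hA]
    · intro d _ hd
      simp [indicatorVec, hc, hd.symm]
    · simp
  · intro h
    refine Finset.sum_eq_zero fun c _ => ?_
    split_ifs with hA
    · simp [indicatorVec, h c hA]
    · rfl

theorem finsum_mem_indicatorVec_student [Fintype S] (T : Set S) (μ : S → Option C) (c : C) :
    ∑ᶠ s ∈ T, indicatorVec μ s (some c) = ((T ∩ assignedSet μ c).ncard : ℝ) := by
  classical
  rw [finsum_mem_eq_sum_ite, ncard_eq_sum_ite]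
  push_cast
  refine Finset.sum_congr rfl fun s _ => ?_
  by_cases hs : s ∈ T <;> simp [hs, indicatorVec, assignedSet]

theorem objX_indicatorVec [Fintype S] [Fintype C] (r : S → Option C → ℝ)
    (hμ : ∀ s c, μ s = some c → i.acc s c) :
    objX i r (indicatorVec μ) = ∑ s, r s (μ s) := by
  refine Finset.sum_congr rfl fun s _ => ?_
  have h := finsum_mem_indicatorVec_school {c | i.acc s c} (fun c => r s (some c)) μ s
  cases hs : μ s with
  | none => rw [h.2 (by simp [hs])]; simp [indicatorVec, hs]
  | some c => rw [h.1 c hs (hμ s c hs)]; simp [indicatorVec, hs]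

theorem stabilityConstraint_indicatorVec_iff [Fintype S] [Fintype C] (hμ : i.IsMatching μ)
    {s : S} {c : C} (ha : i.acc s c) :
    ((i.q c : ℝ) ≤ (i.q c : ℝ) * indicatorVec μ s (some c)
      + (i.q c : ℝ) * (∑ᶠ c' ∈ {c' | i.sPref s c' c}, indicatorVec μ s (some c'))
      + ∑ᶠ s' ∈ {s' | i.cPref c s' s}, indicatorVec μ s' (some c)) ↔ ¬ i.IsBlocking μ s c := by
  rw [finsum_mem_indicatorVec_student]
  have hq : (0 : ℝ) ≤ i.q c := Nat.cast_nonneg _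
  have hn : (0 : ℝ) ≤ (({s' | i.cPref c s' s} ∩ assignedSet μ c).ncard : ℝ) := Nat.cast_nonneg _
  have h := finsum_mem_indicatorVec_school {c' | i.sPref s c' c} (fun _ => 1) μ s
  simp only [one_mul] at h
  by_cases hp : i.prefOver s c (μ s)
  · obtain ⟨h1, h2⟩ := (prefOver_iff (hμ.1 s) ha).1 hp
    rw [h.2 fun d hd => h2 d hd]
    simp only [indicatorVec, h1, if_false, mul_zero, zero_add, Nat.cast_le]
    have hsub : {s' | i.cPref c s' s} ∩ assignedSet μ c ⊆ assignedSet μ c :=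
      Set.inter_subset_right
    constructor
    · rintro hle ⟨-, -, hb | ⟨t, ht, hst⟩⟩
      · exact absurd (Set.ncard_le_ncard hsub (Set.toFinite _)) (by omega)
      · have heq := Set.eq_of_subset_of_ncard_le hsub ((hμ.2 c).trans hle) (Set.toFinite _)
        have ht' : t ∈ assignedSet μ c := ht
        rw [← heq] at ht'
        exact i.cPref_irrefl c s (i.cPref_trans c s t s hst ht'.1)
    · intro hb
      have heq : {s' | i.cPref c s' s} ∩ assignedSet μ c = assignedSet μ c := by
        refine Set.inter_eq_right.2 fun t ht => ?_
        have ht' : μ t = some c := ht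
        refine (i.cPref_total c t s (hμ.1 t c ht) ha ?_).resolve_right fun hst =>
          hb ⟨ha, hp, Or.inr ⟨t, ht, hst⟩⟩
        rintro rfl
        exact h1 ht
      rw [heq]
      exact not_lt.1 fun hlt => hb ⟨ha, hp, Or.inl hlt⟩
  · refine iff_of_true ?_ fun hb => hp hb.2.1
    rw [prefOver_iff (hμ.1 s) ha] at hp
    by_cases hc : μ s = some c
    · rw [h.2 fun d hd hd' => ?_]
      · simp [indicatorVec, hc]
      · rw [hc] at hd'
        cases hd'
        exact i.sPref_irrefl _ _ hd
    · obtain ⟨d, hd, hsd⟩ : ∃ d, i.sPref s d c ∧ μ s = some d := by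
        by_contra! hcon
        exact hp ⟨hc, hcon⟩
      rw [h.1 d hsd hd]
      simp [indicatorVec, hc]

theorem ipFeasible_indicatorVec_iff [Fintype S] [Fintype C]
    (hμ : ∀ s c, μ s = some c → i.acc s c) :
    ipFeasible i (indicatorVec μ) ↔ i.IsStable μ := by
  have hcap : ∀ c, ∑ᶠ s ∈ {s | i.acc s c}, indicatorVec μ s (some c) ≤ (i.q c : ℝ) ↔
      (assignedSet μ c).ncard ≤ i.q c := by
    intro c
    have hsub : assignedSet μ c ⊆ {s | i.acc s c} := fun s hs => hμ s c hs
    rw [finsum_mem_indicatorVec_student, Nat.cast_le, Set.inter_eq_right.2 hsub]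
  constructor
  · rintro ⟨-, -, -, h4, h5⟩
    have hm : i.IsMatching μ := ⟨hμ, fun c => (hcap c).1 (h4 c)⟩
    exact ⟨hm, fun s c hb =>
      (stabilityConstraint_indicatorVec_iff hm hb.1).1 (h5 s c hb.1) hb⟩
  · rintro ⟨hm, hs⟩
    refine ⟨fun s c hc => ?_, fun s o => ?_, fun s => ?_, fun c => (hcap c).2 (hm.2 c),
      fun s c ha => (stabilityConstraint_indicatorVec_iff hm ha).2 (hs s c)⟩
    · exact if_neg fun h => hc (hμ s c h)
    · unfold indicatorVec
      split_ifs <;> simp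
    · have h := finsum_mem_indicatorVec_school {c | i.acc s c} (fun _ => 1) μ s
      simp only [one_mul] at h
      cases hs : μ s with
      | none => rw [h.2 (by simp [hs])]; simp [indicatorVec, hs]
      | some c => rw [h.1 c hs (hμ s c hs)]; simp [indicatorVec, hs]

theorem ipFeasible.exists_eq_indicatorVec [Fintype C] {x : S → Option C → ℝ}
    (hx : ipFeasible i x) :
    ∃ μ : S → Option C, (∀ s c, μ s = some c → i.acc s c) ∧ x = indicatorVec μ := by
  classical
  obtain ⟨hacc, h01, hone, -, -⟩ := hx
  have hsum : ∀ s, ∑ o, x s o = 1 := by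
    intro s
    rw [Fintype.sum_option, ← hone s, finsum_mem_eq_sum_ite]
    congr 1
    refine Finset.sum_congr rfl fun c _ => ?_
    split_ifs with h
    · rfl
    · exact hacc s c h
  have hex : ∀ s, ∃ o, x s o = 1 := by
    intro s
    by_contra! hcon
    have h0 : ∑ o, x s o = 0 :=
      Finset.sum_eq_zero fun o _ => (h01 s o).resolve_right (hcon o)
    linarith [hsum s]
  choose μ hμ using hex
  refine ⟨μ, fun s c hc => ?_, ?_⟩
  · by_contra hn
    have h1 := hμ s
    rw [hc, hacc s c hn] at h1
    exact zero_ne_one h1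
  · funext s o
    unfold indicatorVec
    split_ifs with h
    · rw [← h, hμ s]
    · have h1 := hsum s
      rw [← Finset.add_sum_erase _ _ (Finset.mem_univ (μ s)), hμ s] at h1
      have h0 : ∑ o ∈ Finset.univ.erase (μ s), x s o = 0 := by linarith
      refine (Finset.sum_eq_zero_iff_of_nonneg fun o _ => ?_).1 h0 o (by simp [Ne.symm h])
      rcases h01 s o with h | h <;> simp [h]

end IntegerProgram

end SchoolInstance

/-- For every instance and any penalties `r_{s,∅}`, the indicator vector of a
matching `μ` is an optimal solution of the integer program (1) if and only if `μ` is the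
student-optimal stable matching. -/
theorem indicator_optimal_iff_studentOptimal
    {S C : Type*} [Fintype S] [Fintype C] [DecidableEq C]
    (i : SchoolInstance S C) (r : S → Option C → ℝ)
    (hr : ∀ s c, i.acc s c → r s (some c) = (i.rank s c : ℝ))
    (μ : S → Option C) (hμ : i.IsMatching μ) :
    (ipFeasible i (fun s o => if μ s = o then (1 : ℝ) else 0) ∧
      ∀ x, ipFeasible i x →
        objX i r (fun s o => if μ s = o then (1 : ℝ) else 0) ≤ objX i r x)
    ↔ i.IsStudentOptimal μ := by
  change (ipFeasible i (indicatorVec μ) ∧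
    ∀ x, ipFeasible i x → objX i r (indicatorVec μ) ≤ objX i r x) ↔ _
  rw [ipFeasible_indicatorVec_iff hμ.1, objX_indicatorVec r hμ.1]
  refine and_congr_right fun hst => ⟨fun hopt ν hν s => ?_, fun hopt x hx => ?_⟩
  · have hj := hst.join hν
    have hle := fun t (_ : t ∈ Finset.univ) =>
      le_of_weakPref hr hj hst (weakPref_join_left hst.1 hν.1 t)
    have hge := hopt _ ((ipFeasible_indicatorVec_iff hj.1.1).2 hj)
    rw [objX_indicatorVec r hj.1.1] at hge
    have heq := (Finset.sum_eq_sum_iff_of_le hle).1 ((Finset.sum_le_sum hle).antisymm hge) s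
      (Finset.mem_univ s)
    have hs : i.join μ ν s = μ s := by
      refine (weakPref_join_left hst.1 hν.1 s).resolve_right fun h => ?_
      refine (lt_of_strictPref hr (hj.ne_none hst ?_) h).ne heq
      obtain ⟨c, hc, -⟩ := h
      simp [hc]
    rw [← hs]
    exact weakPref_join_right s
  · obtain ⟨ν, hacc, rfl⟩ := hx.exists_eq_indicatorVec
    have hν := (ipFeasible_indicatorVec_iff hacc).1 hx
    rw [objX_indicatorVec r hacc]
    exact Finset.sum_le_sum fun s _ => le_of_weakPref hr hst hν (hopt ν hν s)
end

section
/- For every instance Γ = ⟨S, C, ≻, q⟩ and budget B ∈ ℕ, the projection onto the (x,t)-variables of the set {(x,t,α) : (x,t) ∈ P_ℤ, α_{s,c} ≥ 0, and the aggregated McCormick linearization constraints hold} equals the set {(x,t) ∈ P_ℤ : the quadratic stability constraints hold}. -/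
open scoped BigOperators

namespace SchoolInstance

variable {S C : Type*} [Fintype S] [Fintype C]

/-- The set of schools weakly preferred by `s` to `c`, i.e. `{c' : c' ⪰_s c}`. -/
def weaklyAbove (i : SchoolInstance S C) (s : S) (c : C) : Set C :=
  {c' | c' = c ∨ i.sPref s c' c}

/-- `(x,t) ∈ P`: fractional (possibly unstable) matchings with capacity expansion,
for a budget `B`. -/
def inP (i : SchoolInstance S C) (B : ℕ) (x : S → Option C → ℝ) (t : C → ℝ) : Prop :=
  (∀ s c, ¬ i.acc s c → x s (some c) = 0) ∧
  (∀ s o, 0 ≤ x s o ∧ x s o ≤ 1) ∧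
  (∀ c, 0 ≤ t c ∧ t c ≤ (B : ℝ)) ∧
  (∀ s, x s none + ∑ᶠ c ∈ {c | i.acc s c}, x s (some c) = 1) ∧
  (∀ c, ∑ᶠ s ∈ {s | i.acc s c}, x s (some c) ≤ (i.q c : ℝ) + t c) ∧
  (∑ c, t c) ≤ (B : ℝ)

/-- `(x,t) ∈ P_ℤ = P ∩ ({0,1}^E × {0,…,B}^C)`. -/
def inPZ (i : SchoolInstance S C) (B : ℕ) (x : S → Option C → ℝ) (t : C → ℝ) : Prop :=
  inP i B x t ∧ (∀ s o, x s o = 0 ∨ x s o = 1) ∧ (∀ c, ∃ n : ℕ, t c = (n : ℝ))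

/-- The quadratic stability constraints
`(t_c + q_c)·(1 − Σ_{c'⪰_s c} x_{s,c'}) ≤ Σ_{s'≻_c s} x_{s',c}` for all `(s,c) ∈ E`, `c ∈ C`. -/
def quadStab (i : SchoolInstance S C) (x : S → Option C → ℝ) (t : C → ℝ) : Prop :=
  ∀ s c, i.acc s c →
    (t c + (i.q c : ℝ)) * (1 - ∑ᶠ c' ∈ i.weaklyAbove s c, x s (some c'))
      ≤ ∑ᶠ s' ∈ {s' | i.cPref c s' s}, x s' (some c)

/-- The aggregated McCormick linearization constraints (with `α_{s,c} ≥ 0`). -/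
def aggMc (i : SchoolInstance S C) (B : ℕ) (x : S → Option C → ℝ) (t : C → ℝ)
    (α : S → C → ℝ) : Prop :=
  ∀ s c, i.acc s c →
    0 ≤ α s c ∧
    (t c - α s c + (i.q c : ℝ) * (1 - ∑ᶠ c' ∈ i.weaklyAbove s c, x s (some c'))
      ≤ ∑ᶠ s' ∈ {s' | i.cPref c s' s}, x s' (some c)) ∧
    (-α s c + t c + (B : ℝ) * ∑ᶠ c' ∈ i.weaklyAbove s c, x s (some c') ≤ (B : ℝ)) ∧
    α s c ≤ t c ∧
    α s c ≤ (B : ℝ) * ∑ᶠ c' ∈ i.weaklyAbove s c, x s (some c')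

/-- The non-aggregated McCormick linearization constraints (with `β_{s,c,c'} ≥ 0`
for `c' ⪰_s c`). -/
def nonAggMc (i : SchoolInstance S C) (B : ℕ) (x : S → Option C → ℝ) (t : C → ℝ)
    (β : S → C → C → ℝ) : Prop :=
  ∀ s c, i.acc s c →
    (t c - (∑ᶠ c' ∈ i.weaklyAbove s c, β s c c')
        + (i.q c : ℝ) * (1 - ∑ᶠ c' ∈ i.weaklyAbove s c, x s (some c'))
      ≤ ∑ᶠ s' ∈ {s' | i.cPref c s' s}, x s' (some c)) ∧
    ∀ c' ∈ i.weaklyAbove s c,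
      0 ≤ β s c c' ∧
      (-β s c c' + t c + (B : ℝ) * x s (some c') ≤ (B : ℝ)) ∧
      β s c c' ≤ t c ∧
      β s c c' ≤ (B : ℝ) * x s (some c')

end SchoolInstance

open SchoolInstance

namespace SchoolInstance

variable {S C : Type*} {i : SchoolInstance S C}

lemma weaklyAbove_subset_acc {s : S} {c : C} (h : i.acc s c) :
    i.weaklyAbove s c ⊆ {c' | i.acc s c'} := by
  rintro c' (rfl | hc)
  · exact h
  · exact (i.sPref_acc _ _ _ hc).1

variable [Fintype C] {B : ℕ} {x : S → Option C → ℝ} {t : C → ℝ}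

/-- For integral `x`, a student is either assigned to exactly one school weakly above `c`,
or to none. -/
lemma inPZ.sum_weaklyAbove_eq_zero_or_one (hP : inPZ i B x t) {s : S} {c : C}
    (h : i.acc s c) :
    ∑ᶠ c' ∈ i.weaklyAbove s c, x s (some c') = 0 ∨
      ∑ᶠ c' ∈ i.weaklyAbove s c, x s (some c') = 1 := by
  classical
  obtain ⟨⟨-, hx, -, hsum, -, -⟩, h01, -⟩ := hP
  have hs := hsum s
  have hle : ∑ᶠ c' ∈ i.weaklyAbove s c, x s (some c') ≤ 1 := by
    rw [finsum_mem_eq_toFinset_sum] at hs ⊢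
    have := Finset.sum_le_sum_of_subset_of_nonneg
      (Set.toFinset_subset_toFinset.2 (weaklyAbove_subset_acc h))
      fun c' _ _ => (hx s (some c')).1
    linarith [(hx s none).1]
  by_cases h0 : ∀ c' ∈ i.weaklyAbove s c, x s (some c') = 0
  · exact .inl (finsum_mem_of_eqOn_zero h0)
  · push Not at h0
    obtain ⟨c', hc', hne⟩ := h0
    refine .inr (le_antisymm hle ?_)
    rw [finsum_mem_eq_toFinset_sum, ← (h01 s (some c')).resolve_left hne]
    exact Finset.single_le_sum (f := fun c' => x s (some c'))
      (fun c' _ => (hx s (some c')).1) (Set.mem_toFinset.2 hc')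

end SchoolInstance

/-- The projection onto the `(x,t)`-variables of the feasible region of the
aggregated McCormick linearization over `P_ℤ` equals the region cut out of `P_ℤ` by the
quadratic stability constraints. -/
theorem aggregated_linearization_exact
    {S C : Type*} [Fintype S] [Fintype C]
    (i : SchoolInstance S C) (B : ℕ) (x : S → Option C → ℝ) (t : C → ℝ) :
    (∃ α : S → C → ℝ, inPZ i B x t ∧ aggMc i B x t α) ↔
      (inPZ i B x t ∧ quadStab i x t) := by
  constructor
  · rintro ⟨α, hP, hα⟩
    refine ⟨hP, fun s c h => ?_⟩
    obtain ⟨-, hstab, -, hle, hle'⟩ := hα s c h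
    rcases hP.sum_weaklyAbove_eq_zero_or_one h with hW | hW <;> rw [hW] at hstab hle' ⊢ <;>
      linarith
  · rintro ⟨hP, hQ⟩
    refine ⟨fun s c => t c * ∑ᶠ c' ∈ i.weaklyAbove s c, x s (some c'), hP, fun s c h => ?_⟩
    have hq := hQ s c h
    obtain ⟨ht0, htB⟩ := hP.1.2.2.1 c
    dsimp only
    rcases hP.sum_weaklyAbove_eq_zero_or_one h with hW | hW <;> rw [hW] at hq ⊢ <;>
      refine ⟨?_, ?_, ?_, ?_, ?_⟩ <;> linarith
end

section
/- For every instance Γ = ⟨S, C, ≻, q⟩ and budget B ∈ ℕ, the projection onto the (x,t)-variables of the set {(x,t,β) : (x,t) ∈ P_ℤ, β_{s,c,c'} ≥ 0, and the non-aggregated McCormick linearization constraints hold} equals the set {(x,t) ∈ P_ℤ : the quadratic stability constraints hold}. -/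
open scoped BigOperators

open SchoolInstance

namespace SchoolInstance

/-- The McCormick envelope of a product with a binary factor is exact. -/
lemma mcCormick_iff_eq_mul {β t x B : ℝ} (ht : 0 ≤ t) (htB : t ≤ B) (hx : x = 0 ∨ x = 1) :
    (0 ≤ β ∧ -β + t + B * x ≤ B ∧ β ≤ t ∧ β ≤ B * x) ↔ β = t * x := by
  rcases hx with rfl | rfl <;> constructor
  · rintro ⟨h₁, h₂, h₃, h₄⟩
    linarith
  · intro h
    refine ⟨?_, ?_, ?_, ?_⟩ <;> linarith
  · rintro ⟨h₁, h₂, h₃, h₄⟩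
    linarith
  · intro h
    refine ⟨?_, ?_, ?_, ?_⟩ <;> linarith

/-- On `P_ℤ`, the McCormick constraints hold for `β` exactly when `β` is the product it
linearizes and the quadratic stability constraints hold. -/
lemma nonAggMc_iff {S C : Type*} [Fintype S] [Fintype C] {i : SchoolInstance S C} {B : ℕ}
    {x : S → Option C → ℝ} {t : C → ℝ} (h : inPZ i B x t) (β : S → C → C → ℝ) :
    nonAggMc i B x t β ↔ quadStab i x t ∧
      ∀ s c, i.acc s c → ∀ c' ∈ i.weaklyAbove s c, β s c c' = t c * x s (some c') := by
  have hmc : ∀ s c c', _ ↔ β s c c' = t c * x s (some c') := fun s c c' =>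
    mcCormick_iff_eq_mul (h.1.2.2.1 c).1 (h.1.2.2.1 c).2 (h.2.1 s (some c'))
  have key : ∀ s c, (∀ c' ∈ i.weaklyAbove s c, β s c c' = t c * x s (some c')) →
      t c - (∑ᶠ c' ∈ i.weaklyAbove s c, β s c c')
        + (i.q c : ℝ) * (1 - ∑ᶠ c' ∈ i.weaklyAbove s c, x s (some c'))
      = (t c + (i.q c : ℝ)) * (1 - ∑ᶠ c' ∈ i.weaklyAbove s c, x s (some c')) := by
    intro s c hβ
    rw [finsum_mem_congr rfl hβ, ← mul_finsum_mem' _ _ (Set.toFinite _)]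
    ring
  simp only [nonAggMc, quadStab, hmc]
  constructor
  · intro H
    exact ⟨fun s c hsc => key s c (H s c hsc).2 ▸ (H s c hsc).1, fun s c hsc => (H s c hsc).2⟩
  · rintro ⟨hq, hβ⟩ s c hsc
    exact ⟨(key s c (hβ s c hsc)).trans_le (hq s c hsc), hβ s c hsc⟩

end SchoolInstance

/-- The projection onto the `(x,t)`-variables of the feasible region of the
non-aggregated McCormick linearization over `P_ℤ` equals the region cut out of `P_ℤ` by the
quadratic stability constraints. -/
theorem non_aggregated_linearization_exact
    {S C : Type*} [Fintype S] [Fintype C]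
    (i : SchoolInstance S C) (B : ℕ) (x : S → Option C → ℝ) (t : C → ℝ) :
    (∃ β : S → C → C → ℝ, inPZ i B x t ∧ nonAggMc i B x t β) ↔
      (inPZ i B x t ∧ quadStab i x t) := by
  constructor
  · rintro ⟨β, h, hβ⟩
    exact ⟨h, ((nonAggMc_iff h β).1 hβ).1⟩
  · rintro ⟨h, hq⟩
    exact ⟨fun s c c' => t c * x s (some c'), h,
      (nonAggMc_iff h _).2 ⟨hq, fun _ _ _ _ _ => rfl⟩⟩
end

section
/- There exist an instance Γ = ⟨S, C, ≻, q⟩ with |S| = 6 and |C| = 4 and a budget B = 1 such that the containment of the relaxed aggregated feasible region in the relaxed non-aggregated feasible region is strict; in particular, the minimum of Σ_{(s,c)∈E} r_{s,c}·x_{s,c} over the projection onto (x,t) of the relaxed non-aggregated feasible region is strictly smaller than the minimum of the same objective over the projection onto (x,t) of the relaxed aggregated feasible region. -/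
open scoped BigOperators

open SchoolInstance

namespace SchoolInstance

variable {S C : Type*} [Fintype S] [Fintype C]

/-- The objective `Σ_{(s,c)∈E, c∈C} r_{s,c}·x_{s,c}`, where `r_{s,c}` is the rank of `c`
in `≻_s`. -/
noncomputable def objRank (i : SchoolInstance S C) (x : S → Option C → ℝ) : ℝ :=
  ∑ s, ∑ᶠ c ∈ {c | i.acc s c}, (i.rank s c : ℝ) * x s (some c)

end SchoolInstance

namespace SchoolInstance

/-- Over a finite type, a finite sum over the elements satisfying `p` is a sum of indicators. -/
lemma finsum_mem_setOf_eq_sum_ite {ι : Type*} [Fintype ι] (p : ι → Prop) [DecidablePred p]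
    (f : ι → ℝ) : ∑ᶠ a ∈ {a | p a}, f a = ∑ a, if p a then f a else 0 := by
  rw [finsum_eq_sum_of_fintype]
  exact Finset.sum_congr rfl fun a _ => finsum_eq_if

/-- Student `0` only accepts school `0`, and students `1` and `2` have school `0` as first choice
and a private fallback school (`1` and `2` respectively). The remaining students and school `3`
are isolated. Every school has one seat, and school `0` prioritizes students by their index. -/
def sharedFirstChoice : SchoolInstance (Fin 6) (Fin 4) where
  q _ := 1
  acc s c := (c = 0 ∧ s ≤ 2) ∨ (c = 1 ∧ s = 1) ∨ (c = 2 ∧ s = 2)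
  sPref s c c' := c = 0 ∧ ((c' = 1 ∧ s = 1) ∨ (c' = 2 ∧ s = 2))
  cPref c s s' := c = 0 ∧ s < s' ∧ s' ≤ 2
  sPref_irrefl := by decide
  sPref_trans := by decide
  sPref_total := by decide
  sPref_acc := by decide
  cPref_irrefl := by decide
  cPref_trans := by decide
  cPref_total := by decide
  cPref_acc := by decide

namespace sharedFirstChoice

instance (s : Fin 6) (c : Fin 4) : Decidable (sharedFirstChoice.acc s c) :=
  inferInstanceAs (Decidable ((c = 0 ∧ s ≤ 2) ∨ (c = 1 ∧ s = 1) ∨ (c = 2 ∧ s = 2)))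

instance (s : Fin 6) (c c' : Fin 4) : Decidable (sharedFirstChoice.sPref s c c') :=
  inferInstanceAs (Decidable (c = 0 ∧ ((c' = 1 ∧ s = 1) ∨ (c' = 2 ∧ s = 2))))

instance (c : Fin 4) (s s' : Fin 6) : Decidable (sharedFirstChoice.cPref c s s') :=
  inferInstanceAs (Decidable (c = 0 ∧ s < s' ∧ s' ≤ 2))

lemma finsum_acc_schools (s : Fin 6) (f : Fin 4 → ℝ) :
    ∑ᶠ c ∈ {c | sharedFirstChoice.acc s c}, f c =
      ∑ c, if (c = 0 ∧ s ≤ 2) ∨ (c = 1 ∧ s = 1) ∨ (c = 2 ∧ s = 2) then f c else 0 :=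
  finsum_mem_setOf_eq_sum_ite _ f

lemma finsum_acc_students (c : Fin 4) (f : Fin 6 → ℝ) :
    ∑ᶠ s ∈ {s | sharedFirstChoice.acc s c}, f s =
      ∑ s, if (c = 0 ∧ s ≤ 2) ∨ (c = 1 ∧ s = 1) ∨ (c = 2 ∧ s = 2) then f s else 0 :=
  finsum_mem_setOf_eq_sum_ite _ f

lemma finsum_weaklyAbove (s : Fin 6) (c : Fin 4) (f : Fin 4 → ℝ) :
    ∑ᶠ c' ∈ sharedFirstChoice.weaklyAbove s c, f c' =
      ∑ c', if c' = c ∨ c' = 0 ∧ ((c = 1 ∧ s = 1) ∨ (c = 2 ∧ s = 2)) then f c' else 0 :=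
  finsum_mem_setOf_eq_sum_ite _ f

lemma finsum_cPref (s : Fin 6) (c : Fin 4) (f : Fin 6 → ℝ) :
    ∑ᶠ s' ∈ {s' | sharedFirstChoice.cPref c s' s}, f s' =
      ∑ s', if c = 0 ∧ s' < s ∧ s ≤ 2 then f s' else 0 :=
  finsum_mem_setOf_eq_sum_ite _ f

lemma rank_eq (s : Fin 6) (c : Fin 4) :
    sharedFirstChoice.rank s c = if (c = 1 ∧ s = 1) ∨ (c = 2 ∧ s = 2) then 2 else 1 := by
  have h : {c' | sharedFirstChoice.sPref s c' c} =
      {c' : Fin 4 | c' = 0 ∧ ((c = 1 ∧ s = 1) ∨ (c = 2 ∧ s = 2))} := rfl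
  unfold rank
  rw [h]
  split_ifs with hc <;> simp [hc]

lemma objRank_eq (x : Fin 6 → Option (Fin 4) → ℝ) :
    sharedFirstChoice.objRank x = x 0 (some 0) + (x 1 (some 0) + 2 * x 1 (some 1)) +
      (x 2 (some 0) + 2 * x 2 (some 2)) := by
  simp only [objRank, finsum_acc_schools, rank_eq]
  simp [Fin.sum_univ_four, Fin.sum_univ_six]

/-- The objective is at least `4` on the relaxed aggregated region. -/
lemma four_le_objRank {x : Fin 6 → Option (Fin 4) → ℝ} {t : Fin 4 → ℝ}
    {α : Fin 6 → Fin 4 → ℝ} (hP : sharedFirstChoice.inP 1 x t)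
    (hA : sharedFirstChoice.aggMc 1 x t α) : 4 ≤ sharedFirstChoice.objRank x := by
  obtain ⟨-, -, ht, -, hcap, -⟩ := hP
  have hcap0 := hcap 0
  have ht0 := (ht 0).2
  obtain ⟨-, h00, -, h00t, -⟩ := hA 0 0 (by decide)
  obtain ⟨-, h11, -, h11t, -⟩ := hA 1 1 (by decide)
  obtain ⟨-, h22, -, h22t, -⟩ := hA 2 2 (by decide)
  rw [finsum_acc_students] at hcap0
  rw [finsum_weaklyAbove, finsum_cPref] at h00 h11 h22
  simp [sharedFirstChoice, Fin.sum_univ_four, Fin.sum_univ_six] at hcap0 ht0 h00 h11 h22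
  rw [objRank_eq]
  linarith

/-- Students `1` and `2` each split `3/4` of their mass over their two schools. -/
noncomputable def splitAssignment (s : Fin 6) : Option (Fin 4) → ℝ
  | none => if s = 0 then 0 else if s ≤ 2 then 1 / 4 else 1
  | some c => ![![1, 0, 0, 0], ![1 / 4, 1 / 2, 0, 0], ![1 / 4, 0, 1 / 2, 0],
      ![0, 0, 0, 0], ![0, 0, 0, 0], ![0, 0, 0, 0]] s c

/-- The capacity expansion accompanying `splitAssignment`. -/
noncomputable def splitExpansion : Fin 4 → ℝ := ![1 / 2, 1 / 4, 1 / 4, 0]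

lemma splitAssignment_mem_Icc (s : Fin 6) (o : Option (Fin 4)) :
    0 ≤ splitAssignment s o ∧ splitAssignment s o ≤ 1 := by
  rcases o with _ | c
  · unfold splitAssignment
    dsimp only
    split_ifs <;> norm_num
  · fin_cases s <;> fin_cases c <;> norm_num [splitAssignment]

lemma splitExpansion_mem_Icc (c : Fin 4) : 0 ≤ splitExpansion c ∧ splitExpansion c ≤ 1 := by
  fin_cases c <;> norm_num [splitExpansion]

lemma inP_split : sharedFirstChoice.inP 1 splitAssignment splitExpansion := by
  refine ⟨fun s c h => ?_, splitAssignment_mem_Icc, by simpa using splitExpansion_mem_Icc,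
    fun s => ?_, fun c => ?_, ?_⟩
  · fin_cases s <;> fin_cases c <;>
      first
      | rfl
      | exact absurd (by decide) h
  · rw [finsum_acc_schools]
    fin_cases s <;> simp [splitAssignment, Fin.sum_univ_four] <;> norm_num
  · rw [finsum_acc_students]
    fin_cases c <;>
      simp [splitAssignment, splitExpansion, sharedFirstChoice, Fin.sum_univ_six] <;> norm_num
  · norm_num [splitExpansion, Fin.sum_univ_succ]

lemma nonAggMc_split : sharedFirstChoice.nonAggMc 1 splitAssignment splitExpansion
    fun s c c' => min (splitExpansion c) (splitAssignment s (some c')) := by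
  intro s c h
  refine ⟨?_, fun c' _ => ?_⟩
  · rw [finsum_weaklyAbove, finsum_weaklyAbove, finsum_cPref]
    have h' : (c = 0 ∧ s = 0) ∨ (c = 0 ∧ s = 1) ∨ (c = 0 ∧ s = 2) ∨ (c = 1 ∧ s = 1) ∨
        (c = 2 ∧ s = 2) := by
      change (c = 0 ∧ s ≤ 2) ∨ (c = 1 ∧ s = 1) ∨ (c = 2 ∧ s = 2) at h
      decide +revert
    rcases h' with ⟨rfl, rfl⟩ | ⟨rfl, rfl⟩ | ⟨rfl, rfl⟩ | ⟨rfl, rfl⟩ | ⟨rfl, rfl⟩ <;>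
      simp [splitAssignment, splitExpansion, sharedFirstChoice, Fin.sum_univ_four,
        Fin.sum_univ_six] <;> norm_num
  · obtain ⟨ht₀, ht₁⟩ := splitExpansion_mem_Icc c
    obtain ⟨hx₀, hx₁⟩ := splitAssignment_mem_Icc s (some c')
    rw [Nat.cast_one, one_mul]
    refine ⟨le_min ht₀ hx₀, ?_, min_le_left _ _, min_le_right _ _⟩
    have : splitExpansion c + splitAssignment s (some c') - 1 ≤
        min (splitExpansion c) (splitAssignment s (some c')) :=
      le_min (by linarith) (by linarith)
    linarith

lemma objRank_split_lt : sharedFirstChoice.objRank splitAssignment < 4 := by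
  rw [objRank_eq]
  simp [splitAssignment]
  norm_num

end sharedFirstChoice

end SchoolInstance

/-- There is an instance with 6 students, 4 schools, and budget `B = 1` for
which the containment of the relaxed aggregated feasible region in the relaxed non-aggregated
one is strict; in particular the minimum of the rank objective over the projection of the
relaxed non-aggregated region is strictly smaller than over that of the relaxed aggregated
region. -/
theorem relaxed_agg_strictly_contained_example :
    ∃ i : SchoolInstance (Fin 6) (Fin 4),
      (∃ (x : Fin 6 → Option (Fin 4) → ℝ) (t : Fin 4 → ℝ),
        (∃ β : Fin 6 → Fin 4 → Fin 4 → ℝ, inP i 1 x t ∧ nonAggMc i 1 x t β) ∧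
        ¬ (∃ α : Fin 6 → Fin 4 → ℝ, inP i 1 x t ∧ aggMc i 1 x t α)) ∧
      (∃ (x : Fin 6 → Option (Fin 4) → ℝ) (t : Fin 4 → ℝ),
        (∃ β : Fin 6 → Fin 4 → Fin 4 → ℝ, inP i 1 x t ∧ nonAggMc i 1 x t β) ∧
        ∀ (x' : Fin 6 → Option (Fin 4) → ℝ) (t' : Fin 4 → ℝ),
          (∃ α : Fin 6 → Fin 4 → ℝ, inP i 1 x' t' ∧ aggMc i 1 x' t' α) →
          SchoolInstance.objRank i x < SchoolInstance.objRank i x') := by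
  have hlt : ∀ (x : Fin 6 → Option (Fin 4) → ℝ) (t : Fin 4 → ℝ),
      (∃ α : Fin 6 → Fin 4 → ℝ, inP sharedFirstChoice 1 x t ∧ aggMc sharedFirstChoice 1 x t α) →
      objRank sharedFirstChoice sharedFirstChoice.splitAssignment < objRank sharedFirstChoice x :=
    fun _ _ ⟨_, hP, hA⟩ => sharedFirstChoice.objRank_split_lt.trans_le
      (sharedFirstChoice.four_le_objRank hP hA)
  have hmem := And.intro sharedFirstChoice.inP_split sharedFirstChoice.nonAggMc_split
  exact ⟨sharedFirstChoice, ⟨_, _, ⟨_, hmem⟩, fun h => (hlt _ _ h).false⟩, ⟨_, _, ⟨_, hmem⟩, hlt⟩⟩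
end

section
/- Let x̄ ∈ {0,1}^E be the indicator vector of a stable matching of the expanded instance Γ_{t̄}, where the expansion t̄ is given by a binary vector ȳ ∈ {0,1}^{C×{0,…,B}} with Σ_{k=0}^B ȳ_c^k = 1 and t̄_c = Σ_{k=0}^B k·ȳ_c^k. If ȳ_c^k = 1 for a school c ∈ C, then for every α > 0 and every comb Ĉ ∈ C_c(k+α) one has Σ_{(s,c')∈Ĉ} x̄_{s,c'} ≥ q_c; that is, all generalized-comb constraints for combs with expansion strictly larger than k are satisfied by (x̄, ȳ). -/
open scoped BigOperators

namespace SchoolInstance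

variable {S C : Type*} [Fintype S] [Fintype C]

/-- The tooth `T(s,c)`: the pair `(s,c)` together with all pairs `(s,c')` with `c' ≻_s c`. -/
def tooth (i : SchoolInstance S C) (s : S) (c : C) : Set (S × C) :=
  insert (s, c) {p : S × C | p.1 = s ∧ i.sPref s p.2 c}

/-- The shaft `S^k(s,c)`: the pair `(s,c)` together with all pairs `(s',c)` with `s' ≻_c s`. -/
def shaft (i : SchoolInstance S C) (s : S) (c : C) : Set (S × C) :=
  insert (s, c) {p : S × C | p.2 = c ∧ i.cPref c p.1 s}

/-- `A ∈ C_c(k)`: `A` is a comb of school `c` with expansion `k`, i.e. the union of a shaft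
`S^k(s,c)` with base `(s,c) ∈ E_c^+(k)` and of exactly `q_c + k` teeth `T(s',c)` with
`(s',c)` in the shaft, one of which is `T(s,c)`. -/
def IsComb (i : SchoolInstance S C) (c : C) (k : ℕ) (A : Set (S × C)) : Prop :=
  ∃ s : S, i.acc s c ∧ i.q c + k - 1 ≤ {s' | i.cPref c s' s}.ncard ∧
    ∃ F : Finset S, (↑F : Set S) ⊆ {s' | (s', c) ∈ i.shaft s c} ∧
      F.card = i.q c + k ∧ s ∈ F ∧
      A = i.shaft s c ∪ ⋃ s' ∈ F, i.tooth s' c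

/-- The value `Σ_{(s,c')∈A} x_{s,c'}` of a set of pairs `A` at `x`. -/
noncomputable def combSum (x : S → Option C → ℝ) (A : Set (S × C)) : ℝ :=
  ∑ᶠ p ∈ A, x p.1 (some p.2)

/-- `(x,y) ∈ P^ext` for budget `B`, where `y_c^k` (for `k ∈ {0,…,B}`) is the unary
description of the capacity expansion of school `c`. -/
def inPext (i : SchoolInstance S C) (B : ℕ) (x : S → Option C → ℝ)
    (y : C → Fin (B + 1) → ℝ) : Prop :=
  (∀ s c, ¬ i.acc s c → x s (some c) = 0) ∧
  (∀ s o, 0 ≤ x s o ∧ x s o ≤ 1) ∧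
  (∀ c k, 0 ≤ y c k ∧ y c k ≤ 1) ∧
  (∀ s, x s none + ∑ᶠ c ∈ {c | i.acc s c}, x s (some c) = 1) ∧
  (∀ c, ∑ᶠ s ∈ {s | i.acc s c}, x s (some c)
      ≤ (i.q c : ℝ) + ∑ k : Fin (B + 1), ((k : ℕ) : ℝ) * y c k) ∧
  ((∑ c, ∑ k : Fin (B + 1), ((k : ℕ) : ℝ) * y c k) ≤ (B : ℝ)) ∧
  (∀ c, ∑ k, y c k = 1)

end SchoolInstance

open SchoolInstance

namespace SchoolInstance

variable {S C : Type*}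

/-- The value of a set of pairs at the indicator vector of `μ` is at least the number of
students whose assigned pair lies in that set. -/
lemma card_le_combSum [Finite S] [Finite C] [DecidableEq C] {μ : S → Option C}
    {x : S → Option C → ℝ} (hx : ∀ s o, x s o = if μ s = o then (1 : ℝ) else 0)
    {A : Set (S × C)} {T : Finset S} (hT : ∀ s ∈ T, ∃ c, μ s = some c ∧ (s, c) ∈ A) :
    (T.card : ℝ) ≤ combSum x A := by
  classical
  have hfin : A.Finite := A.toFinite
  rw [combSum, finsum_mem_eq_finite_toFinset_sum _ hfin]
  simp only [hx, Finset.sum_boole]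
  refine Nat.cast_le.mpr (le_trans (Finset.card_le_card fun s hs => ?_)
    (Finset.card_image_le (f := Prod.fst)))
  obtain ⟨c, hc, hA⟩ := hT s hs
  exact Finset.mem_image.mpr ⟨(s, c), by simp [hc, hA], rfl⟩

/-- In a stable matching, a student who finds `c` acceptable is assigned within the tooth
`T(s,c)` if `c` has a vacant seat or admits someone of lower priority. -/
lemma IsStable.exists_mem_tooth {i : SchoolInstance S C} {μ : S → Option C}
    (hμ : i.IsStable μ) {s : S} {c : C} (hs : i.acc s c)
    (h : (assignedSet μ c).ncard < i.q c ∨ ∃ s', μ s' = some c ∧ i.cPref c s s') :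
    ∃ c', μ s = some c' ∧ (s, c') ∈ i.tooth s c := by
  have hpref : ¬ i.prefOver s c (μ s) := fun hp => hμ.2 s c ⟨hs, hp, h⟩
  cases hm : μ s with
  | none => exact absurd (by simpa [hm, prefOver] using hs) hpref
  | some c' =>
    rw [hm] at hpref
    refine ⟨c', rfl, ?_⟩
    by_cases hcc : c' = c
    · exact Or.inl (by rw [hcc])
    · exact Or.inr ⟨rfl, (i.sPref_total s c' c (hμ.1.1 s c' hm) hs hcc).resolve_right hpref⟩

lemma acc_of_mem_shaft {i : SchoolInstance S C} {s s' : S} {c : C} (hs : i.acc s c)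
    (h : (s', c) ∈ i.shaft s c) : i.acc s' c := by
  rcases h with h | ⟨-, h⟩
  · rwa [(Prod.mk.inj h).1]
  · exact (i.cPref_acc c s' s h).1

lemma cPref_of_mem_shaft {i : SchoolInstance S C} {s s' m : S} {c : C}
    (h : (s', c) ∈ i.shaft s c) (hm : i.cPref c s m) : i.cPref c s' m := by
  rcases h with h | ⟨-, h⟩
  · rwa [(Prod.mk.inj h).1]
  · exact i.cPref_trans c s' s m h hm

/-- For a stable matching of the instance expanded by `t`, every comb of `c` with expansion at
least `t c` has value at least `i.q c + t c`. -/
lemma IsComb.le_combSum [Finite S] [Finite C] [DecidableEq C] {i : SchoolInstance S C}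
    {t : C → ℕ} {μ : S → Option C} (hμ : (i.expand t).IsStable μ)
    {x : S → Option C → ℝ} (hx : ∀ s o, x s o = if μ s = o then (1 : ℝ) else 0)
    {c : C} {k : ℕ} (hk : t c ≤ k) {A : Set (S × C)} (hA : i.IsComb c k A) :
    ((i.q c + t c : ℕ) : ℝ) ≤ combSum x A := by
  classical
  obtain ⟨s, hs, -, F, hF, hcard, -, rfl⟩ := hA
  by_cases h : (assignedSet μ c).ncard < i.q c + t c ∨ ∃ m, μ m = some c ∧ i.cPref c s m
  · have hle : ((i.q c + t c : ℕ) : ℝ) ≤ F.card := by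
      exact_mod_cast (by omega : i.q c + t c ≤ F.card)
    refine hle.trans (card_le_combSum hx fun s' hs' => ?_)
    obtain ⟨c', hc', hmem⟩ := hμ.exists_mem_tooth (s := s') (c := c)
      (acc_of_mem_shaft hs (hF hs'))
      (h.imp_right fun ⟨m, hm, hsm⟩ => ⟨m, hm, cPref_of_mem_shaft (hF hs') hsm⟩)
    exact ⟨c', hc', Or.inr (Set.mem_biUnion (Finset.mem_coe.mpr hs') hmem)⟩
  · push Not at h
    obtain ⟨hfull, hlow⟩ := h
    have hfin : (assignedSet μ c).Finite := Set.toFinite _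
    rw [Set.ncard_eq_toFinset_card _ hfin] at hfull
    refine (Nat.cast_le.mpr hfull).trans (card_le_combSum hx fun m hm => ?_)
    have hm' : μ m = some c := by simpa [assignedSet] using hm
    refine ⟨c, hm', Or.inl ?_⟩
    by_cases hms : m = s
    · exact Or.inl (by rw [hms])
    · exact Or.inr ⟨rfl,
        (i.cPref_total c m s (hμ.1.1 m c hm') hs hms).resolve_right (hlow m hm')⟩

end SchoolInstance

/-- A nonnegative vector with total mass `1` and an entry equal to `1` is a unit vector. -/
lemma eq_zero_of_sum_eq_one {ι : Type*} [Fintype ι] {y : ι → ℝ} (hy : ∀ j, 0 ≤ y j)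
    (hsum : ∑ j, y j = 1) {k : ι} (hk : y k = 1) {j : ι} (hj : j ≠ k) : y j = 0 := by
  classical
  have h := Finset.add_sum_erase Finset.univ y (Finset.mem_univ k)
  have h0 : ∑ j ∈ Finset.univ.erase k, y j = 0 := by linarith
  exact (Finset.sum_eq_zero_iff_of_nonneg fun j _ => hy j).mp h0 j (by simp [hj])

/-- If `x̄` is the indicator vector of a stable matching of the expanded
instance `Γ_t̄` with `t̄` given by the binary vector `ȳ`, and `ȳ_c^k = 1`, then every
generalized-comb constraint of school `c` for combs with expansion `k + α`, `α > 0`, is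
satisfied. -/
theorem comb_constraints_larger_expansion_satisfied
    {S C : Type*} [Fintype S] [Fintype C] [DecidableEq C]
    (i : SchoolInstance S C) (B : ℕ)
    (ybar : C → Fin (B + 1) → ℝ)
    (hybin : ∀ c k, ybar c k = 0 ∨ ybar c k = 1)
    (hysum : ∀ c, ∑ k, ybar c k = 1)
    (tbar : C → ℕ)
    (htbar : ∀ c, (tbar c : ℝ) = ∑ k : Fin (B + 1), ((k : ℕ) : ℝ) * ybar c k)
    (μ : S → Option C) (hμ : (i.expand tbar).IsStable μ)
    (xbar : S → Option C → ℝ)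
    (hxbar : ∀ s o, xbar s o = if μ s = o then (1 : ℝ) else 0)
    (c : C) (k : Fin (B + 1)) (hy1 : ybar c k = 1)
    (α : ℕ) (hα : 0 < α)
    (A : Set (S × C)) (hA : i.IsComb c ((k : ℕ) + α) A) :
    (i.q c : ℝ) ≤ SchoolInstance.combSum xbar A := by
  have hnonneg : ∀ j, 0 ≤ ybar c j := fun j => by
    rcases hybin c j with h | h <;> simp [h]
  have ht : tbar c = k := by
    have h := htbar c
    rw [Finset.sum_eq_single k
      (fun j _ hj => by rw [eq_zero_of_sum_eq_one hnonneg (hysum c) hy1 hj, mul_zero])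
      (by simp), hy1, mul_one] at h
    exact_mod_cast h
  have hcomb := hA.le_combSum hμ hxbar (by omega)
  exact le_trans (by exact_mod_cast Nat.le_add_right _ _) hcomb
end

section
/- For every instance Γ = ⟨S, C, ≻, q⟩ and budget B ∈ ℕ, there is a sufficiently small finite common penalty value (for example r_{s,∅} = |S|·(1 − ξ) for all s ∈ S, where ξ = max_{s∈S} |≻_s| and |≻_s| is the number of schools acceptable to s) such that there exists an optimal solution (t*, μ*) of the capacity expansion problem whose matching has minimum cardinality: |{s ∈ S : μ*(s) ∈ C}| ≤ |{s ∈ S : μ(s) ∈ C}| for every pair (t, μ) with t ∈ ℕ^C, Σ_{c∈C} t_c ≤ B, and μ a stable matching of Γ_t. -/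
open scoped BigOperators

namespace SchoolInstance

variable {S C : Type*} [Fintype S] [Fintype C]

/-- The objective `Σ_{s∈S} r_{s,μ(s)}`, where `r_{s,c}` is the rank of `c` in `≻_s` for
assigned students and `rpen s` is the penalty `r_{s,∅}` for unassigned students. -/
noncomputable def ceObjP (i : SchoolInstance S C) (rpen : S → ℝ) (μ : S → Option C) : ℝ :=
  ∑ s, (μ s).elim (rpen s) (fun c => (i.rank s c : ℝ))

/-- `(t,μ)` is feasible for the capacity expansion problem with budget `B`. -/
def ceFeasible (i : SchoolInstance S C) (B : ℕ) (t : C → ℕ) (μ : S → Option C) : Prop :=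
  (∑ c, t c) ≤ B ∧ (i.expand t).IsStable μ

/-- `(t,μ)` is an optimal solution of the capacity expansion problem with budget `B`
and penalties `rpen`. -/
def ceOptimal (i : SchoolInstance S C) (B : ℕ) (rpen : S → ℝ)
    (t : C → ℕ) (μ : S → Option C) : Prop :=
  ceFeasible i B t μ ∧
  ∀ t' μ', ceFeasible i B t' μ' → ceObjP i rpen μ ≤ ceObjP i rpen μ'

end SchoolInstance

open SchoolInstance

namespace SchoolInstance

/-- The contracts offered when the contracts in `R` have been rejected: each student proposes to
every school all of whose better alternatives have rejected the student. -/
def offered {S C : Type*} (i : SchoolInstance S C) (R : Set (S × C)) : Set (S × C) :=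
  {p | i.acc p.1 p.2 ∧ ∀ c, i.sPref p.1 c p.2 → (p.1, c) ∈ R}

/-- The students who compete with `s` at `c` under the offers `A` and have higher priority. -/
def betterOffers {S C : Type*} (i : SchoolInstance S C) (A : Set (S × C)) (c : C) (s : S) :
    Set S :=
  {s' | (s', c) ∈ A ∧ i.cPref c s' s}

/-- The offers in `A` rejected by schools that keep the best offers up to capacity. -/
def rejected {S C : Type*} (i : SchoolInstance S C) (A : Set (S × C)) : Set (S × C) :=
  {p | p ∈ A ∧ i.q p.2 ≤ (i.betterOffers A p.2 p.1).ncard}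

/-- One round of deferred acceptance, acting on the set of rejected contracts. -/
def rejectionStep {S C : Type*} [Finite S] (i : SchoolInstance S C) :
    Set (S × C) →o Set (S × C) where
  toFun R := i.rejected (i.offered R)
  monotone' := by
    intro R R' h
    have hA : i.offered R ⊆ i.offered R' := fun p hp => ⟨hp.1, fun c hc => h (hp.2 c hc)⟩
    exact fun p hp => ⟨hA hp.1, hp.2.trans
      (Set.ncard_le_ncard (fun s hs => ⟨hA hs.1, hs.2⟩) (Set.toFinite _))⟩

theorem exists_not_rel_of_nonempty {α : Type*} [Finite α] (r : α → α → Prop)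
    (hirr : ∀ a, ¬ r a a) (htrans : ∀ a b c, r a b → r b c → r a c)
    (T : Set α) (hT : T.Nonempty) : ∃ a ∈ T, ∀ b ∈ T, ¬ r b a := by
  have : Std.Irrefl r := ⟨hirr⟩
  have : IsTrans α r := ⟨htrans⟩
  exact (Finite.wellFounded_of_trans_of_irrefl r).has_min T hT

variable {S C : Type*} [Finite S] (i : SchoolInstance S C)

/-- The students whose offers in `A` a school holds on to do not exceed its capacity. -/
theorem ncard_kept_le (A : Set (S × C)) (hA : ∀ p ∈ A, i.acc p.1 p.2) (c : C) :
    {s | (s, c) ∈ A \ i.rejected A}.ncard ≤ i.q c := by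
  have hlt : ∀ s s', (s, c) ∈ A → i.cPref c s s' →
      (i.betterOffers A c s).ncard < (i.betterOffers A c s').ncard := by
    intro s s' hs h
    refine Set.ncard_lt_ncard ⟨fun x hx => ⟨hx.1, i.cPref_trans _ _ _ _ hx.2 h⟩, fun hsub => ?_⟩
      (Set.toFinite _)
    exact i.cPref_irrefl c s (hsub ⟨hs, h⟩ : s ∈ i.betterOffers A c s).2
  have key := Set.ncard_le_ncard_of_injOn (s := {s | (s, c) ∈ A \ i.rejected A})
    (t := Set.Iio (i.q c)) (fun s => (i.betterOffers A c s).ncard) ?_ ?_ (Set.toFinite _)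
  · simpa [Set.ncard_eq_toFinset_card'] using key
  · intro s hs
    by_contra h
    exact hs.2 ⟨hs.1, not_lt.mp h⟩
  · intro s hs s' hs' heq
    by_contra hne
    rcases i.cPref_total c s s' (hA _ hs.1) (hA _ hs'.1) hne with h | h
    · exact (hlt s s' hs.1 h).ne heq
    · exact (hlt s' s hs'.1 h).ne heq.symm

/-- A school that rejects an offer holds on to offers up to its capacity. -/
theorem le_ncard_kept (A : Set (S × C)) (s : S) (c : C) (h : (s, c) ∈ i.rejected A) :
    i.q c ≤ {s | (s, c) ∈ A \ i.rejected A}.ncard := by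
  obtain ⟨s₀, hs₀, hmax⟩ := exists_not_rel_of_nonempty (i.cPref c) (i.cPref_irrefl c)
    (i.cPref_trans c) {s | (s, c) ∈ i.rejected A} ⟨s, h⟩
  exact hs₀.2.trans (Set.ncard_le_ncard (fun x hx => ⟨hx.1, fun hr => hmax x hr hx.2⟩)
    (Set.toFinite _))

/-- The Gale–Shapley theorem: every instance has a stable matching. -/
theorem exists_isStable [Finite C] : ∃ μ : S → Option C, i.IsStable μ := by
  classical
  obtain ⟨R, hR⟩ : ∃ R, i.rejected (i.offered R) = R :=
    ⟨i.rejectionStep.lfp, i.rejectionStep.map_lfp⟩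
  have huniq : ∀ s c c', (s, c) ∈ i.offered R \ R → (s, c') ∈ i.offered R \ R → c = c' := by
    intro s c c' h h'
    by_contra hne
    rcases i.sPref_total s c c' h.1.1 h'.1.1 hne with hp | hp
    · exact h.2 (h'.1.2 c hp)
    · exact h'.2 (h.1.2 c' hp)
  let μ : S → Option C := fun s =>
    if h : ∃ c, (s, c) ∈ i.offered R \ R then some h.choose else none
  have hμ : ∀ s c, μ s = some c ↔ (s, c) ∈ i.offered R \ R := by
    intro s c
    by_cases h : ∃ c, (s, c) ∈ i.offered R \ R
    · simp only [μ, dif_pos h, Option.some.injEq]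
      exact ⟨fun e => e ▸ h.choose_spec, fun hc => huniq s _ _ h.choose_spec hc⟩
    · simp only [μ, dif_neg h]
      exact ⟨fun e => by simp at e, fun hc => absurd ⟨c, hc⟩ h⟩
  have hset : ∀ c, assignedSet μ c = {s | (s, c) ∈ i.offered R \ i.rejected (i.offered R)} := by
    intro c
    ext s
    rw [hR]
    exact hμ s c
  refine ⟨μ, ⟨fun s c h => ((hμ s c).1 h).1.1, fun c => ?_⟩, ?_⟩
  · rw [hset]
    exact i.ncard_kept_le _ (fun p hp => hp.1) c
  rintro s c ⟨hacc, hpref, hblock⟩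
  have hrej : (s, c) ∈ R := by
    cases hs : μ s with
    | some c' =>
      rw [hs] at hpref
      exact ((hμ s c').1 hs).1.2 c hpref
    | none =>
      by_contra hc
      obtain ⟨c₀, ⟨hacc₀, hc₀⟩, hmin⟩ := exists_not_rel_of_nonempty (i.sPref s)
        (i.sPref_irrefl s) (i.sPref_trans s) {c | i.acc s c ∧ (s, c) ∉ R} ⟨c, hacc, hc⟩
      have := (hμ s c₀).2 ⟨⟨hacc₀, fun c' hc' => by
        by_contra hn
        exact hmin c' ⟨(i.sPref_acc s _ _ hc').1, hn⟩ hc'⟩, hc₀⟩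
      simp [hs] at this
  rw [← hR] at hrej
  rcases hblock with hlt | ⟨s', hs', hp⟩
  · rw [hset] at hlt
    exact absurd (i.le_ncard_kept _ s c hrej) (not_le.mpr hlt)
  · have h' := (hμ s' c).1 hs'
    apply h'.2
    rw [← hR]
    exact ⟨h'.1, hrej.2.trans (Set.ncard_le_ncard
      (fun x hx => ⟨hx.1, i.cPref_trans _ _ _ _ hx.2 hp⟩) (Set.toFinite _))⟩

theorem exists_ceOptimal {S C : Type*} [Fintype S] [Fintype C] (i : SchoolInstance S C)
    (B : ℕ) (rpen : S → ℝ) : ∃ t μ, ceOptimal i B rpen t μ := by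
  obtain ⟨μ₀, hμ₀⟩ := (i.expand 0).exists_isStable
  obtain ⟨μ, ⟨t, ht⟩, hmin⟩ := Set.exists_min_image {μ | ∃ t, ceFeasible i B t μ}
    (ceObjP i rpen) (Set.toFinite _) ⟨μ₀, 0, by simp, hμ₀⟩
  exact ⟨t, μ, ht, fun t' μ' h' => hmin μ' ⟨t', h'⟩⟩

theorem rank_le {S C : Type*} [Fintype C] (i : SchoolInstance S C) (s : S) (c : C) :
    i.rank s c ≤ 1 + Fintype.card C := by
  have h := Set.ncard_le_card {c' | i.sPref s c' c}
  rw [Nat.card_eq_fintype_card] at h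
  exact Nat.add_le_add_left h 1

/-- Up to the total rank of the assigned students, which is at most `|S| * (1 + |C|)`, the
objective with a common penalty is the penalty times the number of unassigned students. -/
theorem ceObjP_mem_Icc {S C : Type*} [Fintype S] [Fintype C] (i : SchoolInstance S C)
    (r : ℝ) (μ : S → Option C) :
    ceObjP i (fun _ => r) μ ∈
      Set.Icc ((Fintype.card S - {s | ∃ c, μ s = some c}.ncard : ℝ) * r)
        ((Fintype.card S - {s | ∃ c, μ s = some c}.ncard : ℝ) * r
          + Fintype.card S * (1 + Fintype.card C)) := by
  classical
  have hcount : (Fintype.card S - {s | ∃ c, μ s = some c}.ncard : ℝ) * r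
      = ∑ s, (μ s).elim r (fun _ => 0) := by
    have hn : {s | ∃ c, μ s = some c}.ncard
        = (Finset.univ.filter fun s => ∃ c, μ s = some c).card := by
      rw [Set.ncard_eq_toFinset_card', Set.toFinset_ofPred]
    have hterm : ∀ s, (μ s).elim r (fun _ => 0) = r - if ∃ c, μ s = some c then r else 0 := by
      intro s
      cases μ s <;> simp
    rw [hn, Finset.sum_congr rfl fun s _ => hterm s, Finset.sum_sub_distrib,
      ← Finset.sum_filter]
    simp [sub_mul]
  rw [hcount]
  constructor
  · refine Finset.sum_le_sum fun s _ => ?_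
    cases μ s <;> simp
  · have hconst : (Fintype.card S * (1 + Fintype.card C) : ℝ)
        = ∑ _s : S, (1 + Fintype.card C : ℝ) := by simp [mul_add]
    rw [hconst, ← Finset.sum_add_distrib]
    refine Finset.sum_le_sum fun s _ => ?_
    cases μ s with
    | none => simp only [Option.elim_none, le_add_iff_nonneg_right]; positivity
    | some c => simpa using (by exact_mod_cast i.rank_le s c :
        (i.rank s c : ℝ) ≤ 1 + Fintype.card C)

end SchoolInstance

/-- For every instance and budget there is a sufficiently small finite
common penalty value (e.g. `|S|·(1 − ξ)` with `ξ = max_s |≻_s|`) such that some optimal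
solution of the capacity expansion problem is a stable matching of minimum cardinality among
all feasible solutions. -/
theorem small_penalty_min_cardinality
    {S C : Type*} [Fintype S] [Fintype C]
    (i : SchoolInstance S C) (B : ℕ) :
    ∃ (rbar : ℝ) (tstar : C → ℕ) (μstar : S → Option C),
      ceOptimal i B (fun _ => rbar) tstar μstar ∧
      ∀ t μ, ceFeasible i B t μ →
        {s | ∃ c, μstar s = some c}.ncard ≤ {s | ∃ c, μ s = some c}.ncard := by
  obtain ⟨t, μ, hopt⟩ := exists_ceOptimal i B
    (fun _ => -((Fintype.card S : ℝ) * (1 + Fintype.card C) + 1))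
  refine ⟨_, t, μ, hopt, fun t' μ' hfeas => ?_⟩
  by_contra! hlt
  have hle := hopt.2 t' μ' hfeas
  have hlower := (ceObjP_mem_Icc i (-((Fintype.card S : ℝ) * (1 + Fintype.card C) + 1)) μ).1
  have hupper := (ceObjP_mem_Icc i (-((Fintype.card S : ℝ) * (1 + Fintype.card C) + 1)) μ').2
  have hcard : ({s | ∃ c, μ' s = some c}.ncard : ℝ) + 1
      ≤ ({s | ∃ c, μ s = some c}.ncard : ℝ) := by exact_mod_cast hlt
  have hK : (0 : ℝ) ≤ Fintype.card S * (1 + Fintype.card C) := by positivity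
  nlinarith
end

section
/- For every instance Γ = ⟨S, C, ≻, q⟩ and budget B ∈ ℕ, there is a sufficiently large finite common penalty value (any r̄ with r_{s,∅} = r̄ for all s ∈ S and r̄ > Σ_{s∈S} |≻_s|, where |≻_s| is the number of schools acceptable to s) such that every optimal solution (t*, μ*) of the capacity expansion problem has a matching of maximum cardinality: |{s ∈ S : μ*(s) ∈ C}| ≥ |{s ∈ S : μ(s) ∈ C}| for every pair (t, μ) with t ∈ ℕ^C, Σ_{c∈C} t_c ≤ B, and μ a stable matching of Γ_t. -/
open scoped BigOperators

open SchoolInstance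

namespace SchoolInstance

variable {S C : Type*}

/-- The rank of an acceptable school is at most the number of acceptable schools. -/
lemma rank_le_ncard_acc [Fintype C] (i : SchoolInstance S C) {s : S} {c : C} (h : i.acc s c) :
    i.rank s c ≤ {c | i.acc s c}.ncard := by
  have hc : c ∉ {c' | i.sPref s c' c} := i.sPref_irrefl s c
  have hsub : insert c {c' | i.sPref s c' c} ⊆ {c | i.acc s c} := by
    rintro x (rfl | hx)
    · exact h
    · exact (i.sPref_acc s x c hx).1
  have hle := Set.ncard_le_ncard hsub (Set.toFinite _)
  rw [Set.ncard_insert_of_notMem hc (Set.toFinite _)] at hle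
  rw [rank]
  omega

open scoped Classical in
/-- The assigned students together with the unassigned ones make up all students. -/
lemma ncard_assigned_add_card_unassigned [Fintype S] (μ : S → Option C) :
    {s | ∃ c, μ s = some c}.ncard + (Finset.univ.filter fun s => μ s = none).card =
      Fintype.card S := by
  have h : {s | ∃ c, μ s = some c} = ↑(Finset.univ.filter fun s => ¬ μ s = none) := by
    ext s
    simp [Option.ne_none_iff_exists']
  rw [h, Set.ncard_coe_finset, add_comm, Finset.card_filter_add_card_filter_not,
    Finset.card_univ]

open scoped Classical in
/-- The objective is at least the total penalty of the unassigned students. -/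
lemma card_unassigned_mul_le_ceObjP [Fintype S] (i : SchoolInstance S C) (r : ℝ)
    (μ : S → Option C) :
    ((Finset.univ.filter fun s => μ s = none).card : ℝ) * r ≤ ceObjP i (fun _ => r) μ := by
  rw [← nsmul_eq_mul, ← Finset.sum_const, Finset.sum_filter, ceObjP]
  refine Finset.sum_le_sum fun s _ => ?_
  cases μ s <;> simp

open scoped Classical in
/-- The objective of an assignment to acceptable schools exceeds the total penalty of the
unassigned students by at most the total length of the preference lists. -/
lemma ceObjP_le_sum_add_card_unassigned_mul [Fintype S] [Fintype C]
    (i : SchoolInstance S C) (r : ℝ) (μ : S → Option C) (hμ : ∀ s c, μ s = some c → i.acc s c) :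
    ceObjP i (fun _ => r) μ ≤ (∑ s, ({c | i.acc s c}.ncard : ℝ)) +
      ((Finset.univ.filter fun s => μ s = none).card : ℝ) * r := by
  rw [← nsmul_eq_mul, ← Finset.sum_const, Finset.sum_filter, ← Finset.sum_add_distrib, ceObjP]
  refine Finset.sum_le_sum fun s _ => ?_
  cases h : μ s with
  | none => simp
  | some c => simpa using i.rank_le_ncard_acc (hμ s c h)

end SchoolInstance

/-- For every instance and budget, if the common penalty `r̄` satisfies
`r̄ > Σ_{s∈S} |≻_s|`, then every optimal solution of the capacity expansion problem is a
stable matching of maximum cardinality among all feasible solutions. -/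
theorem large_penalty_max_cardinality
    {S C : Type*} [Fintype S] [Fintype C]
    (i : SchoolInstance S C) (B : ℕ) (rbar : ℝ)
    (hrbar : (∑ s, ({c | i.acc s c}.ncard : ℝ)) < rbar)
    (tstar : C → ℕ) (μstar : S → Option C)
    (hopt : ceOptimal i B (fun _ => rbar) tstar μstar) :
    ∀ t μ, ceFeasible i B t μ →
      {s | ∃ c, μ s = some c}.ncard ≤ {s | ∃ c, μstar s = some c}.ncard := by
  classical
  intro t μ hμ
  by_contra! hlt
  have hupper := ceObjP_le_sum_add_card_unassigned_mul i rbar μ hμ.2.1.1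
  have hlower := card_unassigned_mul_le_ceObjP i rbar μstar
  have hle := hopt.2 t μ hμ
  have hsum := ncard_assigned_add_card_unassigned μ
  have hsumstar := ncard_assigned_add_card_unassigned μstar
  have hr : 0 ≤ rbar := (Finset.sum_nonneg fun s _ => Nat.cast_nonneg _).trans hrbar.le
  have hcard : (Finset.univ.filter fun s => μ s = none).card + 1 ≤
      (Finset.univ.filter fun s => μstar s = none).card := by omega
  have hmul := mul_le_mul_of_nonneg_right (Nat.cast_le (α := ℝ).2 hcard) hr
  push_cast at hmul
  linarith
end

section
/- The capacity-planning mechanism is not strategy-proof for students: there exist an instance Γ = ⟨S, C, ≻, q⟩ (one can take |S| = |C| = 5 with all capacities equal to 1), a budget B = 1, penalty values, a student s ∈ S, and a misreported preference order ≻'_s for s (all other reports unchanged), such that in every optimal solution (t, μ) of the capacity expansion problem for the truthful instance the student s is assigned some school c, in every optimal solution (t', μ') for the misreported instance the student s is assigned some school c', and c' ≻_s c with respect to s's true preferences. -/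
open scoped BigOperators

open SchoolInstance

/-- A market in which student `0` either reports `0 ≻ 1` (`full = true`) or finds only school `0`
acceptable (`full = false`). Students `1`, `2`, `3`, `4` find acceptable only the schools
`0`, `2`, `2`, `3` respectively; school `0` ranks `1 ≻ 0` and school `2` ranks `3 ≻ 2`. -/
def truncationMarket (full : Bool) : SchoolInstance (Fin 5) (Fin 5) where
  q _ := 1
  acc s c := (s = 0 ∧ c = 0) ∨ (full = true ∧ s = 0 ∧ c = 1) ∨ (s = 1 ∧ c = 0) ∨
    (s = 2 ∧ c = 2) ∨ (s = 3 ∧ c = 2) ∨ (s = 4 ∧ c = 3)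
  sPref s c c' := full = true ∧ s = 0 ∧ c = 0 ∧ c' = 1
  cPref c s s' := (c = 0 ∧ s = 1 ∧ s' = 0) ∨ (c = 2 ∧ s = 3 ∧ s' = 2)
  sPref_irrefl := by grind
  sPref_trans := by grind
  sPref_total := by grind (splits := 20)
  sPref_acc := by grind
  cPref_irrefl := by grind
  cPref_trans := by grind
  cPref_total := by grind (splits := 20)
  cPref_acc := by grind

/-- Being unassigned costs `3` for students `2` and `3`, and `10` for everyone else. -/
def truncationPenalty : Fin 5 → ℝ := ![10, 10, 3, 3, 10]

lemma SchoolInstance.one_le_rank {S C : Type*} (i : SchoolInstance S C) (s : S) (c : C) :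
    (1 : ℝ) ≤ i.rank s c := by
  simp [SchoolInstance.rank]

lemma SchoolInstance.one_le_cost {S C : Type*} (i : SchoolInstance S C) {rpen : S → ℝ} {s : S}
    (h : 1 ≤ rpen s) (o : Option C) :
    1 ≤ o.elim (rpen s) (fun c => (i.rank s c : ℝ)) := by
  cases o
  · exact h
  · exact i.one_le_rank s _

lemma truncationMarket_rank (full : Bool) (s c : Fin 5) :
    (truncationMarket full).rank s c = if full = true ∧ s = 0 ∧ c = 1 then 2 else 1 := by
  unfold SchoolInstance.rank truncationMarket
  split_ifs with h
  · simp [h]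
  · have : {c' : Fin 5 | full = true ∧ s = 0 ∧ c' = 0 ∧ c = 1} = ∅ := by
      ext c'; simp only [Set.mem_ofPred_eq, Set.mem_empty_iff_false]; tauto
    simp [this]

lemma ncard_assignedSet {S C : Type*} [Fintype S] [DecidableEq C] (μ : S → Option C) (c : C) :
    (assignedSet μ c).ncard = (Finset.univ.filter fun s => μ s = some c).card := by
  rw [← Set.ncard_coe_finset]
  simp [assignedSet]

/-- With the full report, expanding school `2` admits a stable matching placing everyone. -/
lemma ceFeasible_truncationMarket_true :
    ceFeasible (truncationMarket true) 1 (Pi.single 2 1)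
      ![some 1, some 0, some 2, some 2, some 3] := by
  refine ⟨by decide, ⟨?_, fun c => ?_⟩, ?_⟩
  · simp only [expand, truncationMarket]; decide
  · rw [ncard_assignedSet]; simp only [expand, truncationMarket]; revert c; decide
  · rintro s c ⟨h1, h2, h3⟩
    rw [ncard_assignedSet] at h3
    simp only [expand, truncationMarket] at h1 h3
    fin_cases s <;> fin_cases c <;> simp [prefOver, expand, truncationMarket] at h1 h2 <;>
      (revert h3; decide)

/-- With the truncated report, expanding school `0` admits a stable matching placing everyone
but student `2`. -/
lemma ceFeasible_truncationMarket_false :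
    ceFeasible (truncationMarket false) 1 (Pi.single 0 1)
      ![some 0, some 0, none, some 2, some 3] := by
  refine ⟨by decide, ⟨?_, fun c => ?_⟩, ?_⟩
  · simp only [expand, truncationMarket]; decide
  · rw [ncard_assignedSet]; simp only [expand, truncationMarket]; revert c; decide
  · rintro s c ⟨h1, h2, h3⟩
    rw [ncard_assignedSet] at h3
    simp only [expand, truncationMarket] at h1 h3
    fin_cases s <;> fin_cases c <;> simp [prefOver, expand, truncationMarket] at h1 h2 <;>
      (revert h3; decide)

lemma ceObjP_truncationMarket_true :
    ceObjP (truncationMarket true) truncationPenalty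
      ![some 1, some 0, some 2, some 2, some 3] = 6 := by
  simp [ceObjP, Fin.sum_univ_five, truncationMarket_rank]
  norm_num

lemma ceObjP_truncationMarket_false :
    ceObjP (truncationMarket false) truncationPenalty
      ![some 0, some 0, none, some 2, some 3] = 7 := by
  simp [ceObjP, Fin.sum_univ_five, truncationMarket_rank, truncationPenalty]
  norm_num

/-- Two students can share a school of unit capacity only if it is expanded. -/
lemma one_le_of_shared_school {full : Bool} {t : Fin 5 → ℕ} {μ : Fin 5 → Option (Fin 5)}
    (h : ((truncationMarket full).expand t).IsMatching μ) {s s' c : Fin 5} (hne : s ≠ s')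
    (hs : μ s = some c) (hs' : μ s' = some c) : 1 ≤ t c := by
  have h2 : 1 < (assignedSet μ c).ncard :=
    (Set.one_lt_ncard (Set.toFinite _)).2 ⟨s, hs, s', hs', hne⟩
  have h3 : (assignedSet μ c).ncard ≤ 1 + t c := h.2 c
  omega

lemma one_le_truncationPenalty (s : Fin 5) : 1 ≤ truncationPenalty s := by
  fin_cases s <;> norm_num [truncationPenalty]

lemma le_ceObjP_of_eq_none (full : Bool) {μ : Fin 5 → Option (Fin 5)} {s : Fin 5}
    (h : μ s = none) :
    truncationPenalty s + 4 ≤ ceObjP (truncationMarket full) truncationPenalty μ := by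
  have hcost := fun s => (truncationMarket full).one_le_cost (one_le_truncationPenalty s) (μ s)
  rw [ceObjP, ← Finset.add_sum_erase _ _ (Finset.mem_univ s), h, Option.elim_none]
  gcongr
  calc (4 : ℝ) = ∑ _x ∈ Finset.univ.erase s, 1 := by simp
    _ ≤ _ := Finset.sum_le_sum fun x _ => hcost x

lemma seven_le_ceObjP_of_eq_none (full : Bool) {μ : Fin 5 → Option (Fin 5)} {s : Fin 5}
    (h : μ s = none) : 7 ≤ ceObjP (truncationMarket full) truncationPenalty μ := by
  have hpen : 3 ≤ truncationPenalty s := by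
    fin_cases s <;> norm_num [truncationPenalty]
  linarith [le_ceObjP_of_eq_none full h]

/-- A budget of one seat cannot place everyone when student `0` takes a seat at school `0`. -/
lemma exists_unassigned {full : Bool} {t : Fin 5 → ℕ} {μ : Fin 5 → Option (Fin 5)}
    (h : ceFeasible (truncationMarket full) 1 t μ) (h0 : μ 0 = some 0) : ∃ s, μ s = none := by
  obtain ⟨ht, hm, -⟩ := h
  by_contra! hsome
  have hacc : ∀ s, ∃ c, μ s = some c ∧ (truncationMarket full).acc s c := fun s => by
    obtain ⟨c, hc⟩ := Option.ne_none_iff_exists'.1 (hsome s)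
    exact ⟨c, hc, hm.1 s c hc⟩
  obtain ⟨c1, h1, a1⟩ := hacc 1
  obtain ⟨c2, h2, a2⟩ := hacc 2
  obtain ⟨c3, h3, a3⟩ := hacc 3
  simp [truncationMarket] at a1 a2 a3
  subst a1 a2 a3
  have e0 := one_le_of_shared_school hm (by decide) h0 h1
  have e2 := one_le_of_shared_school hm (by decide) h2 h3
  rw [Fin.sum_univ_five] at ht
  omega

/-- With the full report, student `0` gets the second choice or the objective exceeds `6`. -/
lemma ceObjP_dichotomy_true {t : Fin 5 → ℕ} {μ : Fin 5 → Option (Fin 5)}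
    (h : ceFeasible (truncationMarket true) 1 t μ) :
    (μ 0 = some 1 ∧ 6 ≤ ceObjP (truncationMarket true) truncationPenalty μ) ∨
      7 ≤ ceObjP (truncationMarket true) truncationPenalty μ := by
  cases h0 : μ 0 with
  | none => exact .inr (seven_le_ceObjP_of_eq_none true h0)
  | some c =>
    have a0 := h.2.1.1 0 c h0
    simp [expand, truncationMarket] at a0
    rcases a0 with rfl | rfl
    · obtain ⟨s, hs⟩ := exists_unassigned h h0
      exact .inr (seven_le_ceObjP_of_eq_none true hs)
    · refine .inl ⟨rfl, ?_⟩
      have hcost := fun s =>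
        (truncationMarket true).one_le_cost (one_le_truncationPenalty s) (μ s)
      have hrank : ((truncationMarket true).rank 0 1 : ℝ) = 2 := by simp [truncationMarket_rank]
      rw [ceObjP, Fin.sum_univ_five, h0, Option.elim_some, hrank]
      linarith [hcost 1, hcost 2, hcost 3, hcost 4]

/-- With the truncated report, student `0` gets the first choice or the objective is at least
`14`. -/
lemma ceObjP_dichotomy_false {t : Fin 5 → ℕ} {μ : Fin 5 → Option (Fin 5)}
    (h : ceFeasible (truncationMarket false) 1 t μ) :
    (μ 0 = some 0 ∧ 7 ≤ ceObjP (truncationMarket false) truncationPenalty μ) ∨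
      14 ≤ ceObjP (truncationMarket false) truncationPenalty μ := by
  cases h0 : μ 0 with
  | none =>
    have hlow := le_ceObjP_of_eq_none false h0
    norm_num [truncationPenalty] at hlow
    exact .inr hlow
  | some c =>
    have a0 := h.2.1.1 0 c h0
    simp [expand, truncationMarket] at a0
    subst a0
    obtain ⟨s, hs⟩ := exists_unassigned h h0
    exact .inl ⟨rfl, seven_le_ceObjP_of_eq_none false hs⟩

/-- The capacity-planning mechanism is not strategy-proof for students:
there are an instance with 5 students and 5 schools of unit capacity, budget `B = 1`,
penalties, a student `s`, and a misreport `≻'_s` (all other reports unchanged) such that `s`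
is assigned a school `c` in every optimal solution of the truthful instance, a school `c'` in
every optimal solution of the misreported instance, and `c' ≻_s c` for `s`'s true
preferences. -/
theorem not_strategyproof_for_students :
    ∃ (i i' : SchoolInstance (Fin 5) (Fin 5)) (rpen : Fin 5 → ℝ) (s : Fin 5),
      (∀ c, i.q c = 1) ∧
      i'.q = i.q ∧
      i'.cPref = i.cPref ∧
      (∀ s', s' ≠ s → i'.acc s' = i.acc s') ∧
      (∀ s', s' ≠ s → i'.sPref s' = i.sPref s') ∧
      (∃ t μ, ceOptimal i 1 rpen t μ) ∧
      (∃ t' μ', ceOptimal i' 1 rpen t' μ') ∧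
      ∃ c c' : Fin 5,
        (∀ t μ, ceOptimal i 1 rpen t μ → μ s = some c) ∧
        (∀ t' μ', ceOptimal i' 1 rpen t' μ' → μ' s = some c') ∧
        i.sPref s c' c := by
  refine ⟨truncationMarket true, truncationMarket false, truncationPenalty, 0, fun _ => rfl, rfl,
    rfl, fun s hs => ?_, fun s hs => ?_,
    ⟨_, _, ceFeasible_truncationMarket_true, fun t μ h => ?_⟩,
    ⟨_, _, ceFeasible_truncationMarket_false, fun t μ h => ?_⟩, 1, 0,
    fun t μ h => ?_, fun t μ h => ?_, ?_⟩
  · funext c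
    simp [truncationMarket, hs]
  · funext c c'
    simp [truncationMarket, hs]
  · rw [ceObjP_truncationMarket_true]
    rcases ceObjP_dichotomy_true h with ⟨-, h⟩ | h <;> linarith
  · rw [ceObjP_truncationMarket_false]
    rcases ceObjP_dichotomy_false h with ⟨-, h⟩ | h <;> linarith
  · have hle := h.2 _ _ ceFeasible_truncationMarket_true
    rw [ceObjP_truncationMarket_true] at hle
    rcases ceObjP_dichotomy_true h.1 with ⟨h0, -⟩ | h
    · exact h0
    · linarith
  · have hle := h.2 _ _ ceFeasible_truncationMarket_false
    rw [ceObjP_truncationMarket_false] at hle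
    rcases ceObjP_dichotomy_false h.1 with ⟨h0, -⟩ | h
    · exact h0
    · linarith
  · simp [truncationMarket]
end

section
/- The function f is not lattice submodular: there exist an instance Γ = ⟨S, C, ≻, q⟩ and vectors t, t' ∈ ℕ^C such that f(t ∨ t') + f(t ∧ t') > f(t) + f(t'), where ∨ and ∧ denote componentwise maximum and minimum. -/
open scoped BigOperators

open SchoolInstance

namespace SchoolInstance

variable {S C : Type*} [Fintype S] [Fintype C]

/-- The set of objective values of stable matchings of the expanded instance `Γ_t`;
its least element is `f(t)`. -/
def objValSet (i : SchoolInstance S C) (rpen : S → ℝ) (t : C → ℕ) : Set ℝ :=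
  {v | ∃ μ : S → Option C, (i.expand t).IsStable μ ∧ v = ceObjP i rpen μ}

end SchoolInstance

namespace SchoolInstance

/-- One student who prefers the first of two schools to the second, both without seats. -/
def oneStudent : SchoolInstance (Fin 1) (Fin 2) where
  q _ := 0
  acc _ _ := True
  sPref _ c c' := c < c'
  cPref _ _ _ := False
  sPref_irrefl _ c := lt_irrefl c
  sPref_trans _ _ _ _ := lt_trans
  sPref_total _ _ _ _ _ h := lt_or_gt_of_ne h
  sPref_acc _ _ _ _ := ⟨trivial, trivial⟩
  cPref_irrefl _ _ := id
  cPref_trans _ _ _ _ h _ := h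
  cPref_total _ s₁ s₂ _ _ h := (h (Subsingleton.elim s₁ s₂)).elim
  cPref_acc _ _ _ h := h.elim

lemma ncard_assignedSet_fin_one {C : Type*} [DecidableEq C] (μ : Fin 1 → Option C) (c : C) :
    (assignedSet μ c).ncard = if μ 0 = some c then 1 else 0 := by
  split_ifs with h
  · rw [Set.ncard_eq_one]
    exact ⟨0, by ext s; simp [assignedSet, Subsingleton.elim s 0, h]⟩
  · rw [Set.ncard_eq_zero]
    ext s
    simp [assignedSet, Subsingleton.elim s 0, h]

/-- A matching is stable iff the student occupies an existing seat and every school they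
strictly prefer has no seats. -/
lemma oneStudent_isStable_iff (t : Fin 2 → ℕ) (μ : Fin 1 → Option (Fin 2)) :
    (oneStudent.expand t).IsStable μ ↔
      (∀ c, μ 0 = some c → 0 < t c) ∧ ∀ c, (∀ c', μ 0 = some c' → c < c') → t c = 0 := by
  simp only [IsStable, IsMatching, IsBlocking, ncard_assignedSet_fin_one, Fin.forall_fin_one]
  rcases h : μ 0 with _ | d
  · simp [prefOver, expand, oneStudent]
  · simp only [prefOver, expand, oneStudent, Option.some.injEq, forall_eq']
    simp only [true_and, zero_add, and_false, exists_false, or_false, not_and,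
      not_lt]
    refine and_congr ⟨fun H => by simpa [Nat.one_le_iff_ne_zero, Nat.pos_iff_ne_zero] using H d,
      fun H c => ?_⟩ (forall_congr' fun c => forall_congr' fun hc => ?_)
    · split_ifs with hd
      · exact hd ▸ H
      · exact Nat.zero_le _
    · rw [if_neg hc.ne', Nat.le_zero]

lemma oneStudent_rank (c : Fin 2) : oneStudent.rank 0 c = 1 + c := by
  have h : {c' | oneStudent.sPref 0 c' c} = Set.Iio c := rfl
  rw [rank, h, Set.ncard_eq_toFinset_card']
  simp

/-- If `o` is the assignment in some stable matching and in no other, its value is `f(t)`. -/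
lemma oneStudent_isLeast (rpen : Fin 1 → ℝ) (t : Fin 2 → ℕ) (o : Option (Fin 2))
    (h : ∀ o', ((∀ c, o' = some c → 0 < t c) ∧
      ∀ c, (∀ c', o' = some c' → c < c') → t c = 0) ↔ o' = o) :
    IsLeast (objValSet oneStudent rpen t) (o.elim (rpen 0) fun c => 1 + (c : ℕ)) := by
  have hv (μ : Fin 1 → Option (Fin 2)) :
      ceObjP oneStudent rpen μ = (μ 0).elim (rpen 0) fun c => 1 + (c : ℕ) := by
    simp [ceObjP, oneStudent_rank]
  refine ⟨⟨fun _ => o, (oneStudent_isStable_iff t _).2 ((h o).2 rfl), (hv fun _ => o).symm⟩, ?_⟩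
  rintro _ ⟨μ, hμ, rfl⟩
  rw [hv, (h _).1 ((oneStudent_isStable_iff t μ).1 hμ)]

end SchoolInstance

/-- The function `f` (value of the student-optimal stable matching of
`Γ_t`) is not lattice submodular: on some instance there are `t, t'` with
`f(t ∨ t') + f(t ∧ t') > f(t) + f(t')`. -/
theorem f_not_lattice_submodular :
    ∃ (nS nC : ℕ) (i : SchoolInstance (Fin nS) (Fin nC)) (rpen : Fin nS → ℝ)
      (t t' : Fin nC → ℕ) (v₁ v₂ v₃ v₄ : ℝ),
      IsLeast (SchoolInstance.objValSet i rpen (fun c => max (t c) (t' c))) v₁ ∧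
      IsLeast (SchoolInstance.objValSet i rpen (fun c => min (t c) (t' c))) v₂ ∧
      IsLeast (SchoolInstance.objValSet i rpen t) v₃ ∧
      IsLeast (SchoolInstance.objValSet i rpen t') v₄ ∧
      v₃ + v₄ < v₁ + v₂ := by
  refine ⟨1, 2, oneStudent, fun _ => 3, ![1, 0], ![0, 1], _, _, _, _,
    oneStudent_isLeast _ _ (some 0) ?_, oneStudent_isLeast _ _ none ?_,
    oneStudent_isLeast _ _ (some 0) ?_, oneStudent_isLeast _ _ (some 1) ?_, ?_⟩
  · decide
  · decide
  · decide
  · decide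
  · norm_num
end

section
/- The function f is not lattice supermodular: there exist an instance Γ = ⟨S, C, ≻, q⟩ and vectors t, t' ∈ ℕ^C such that f(t ∨ t') + f(t ∧ t') < f(t) + f(t'), where ∨ and ∧ denote componentwise maximum and minimum. -/
open scoped BigOperators

open SchoolInstance

namespace SchoolInstance

/-- Student `0` prefers school `0` to school `1`; students `1` and `2` accept only school `1`.
School `1`, with one seat, ranks the students `0, 1, 2`, and school `0` has no seat. -/
def competition : SchoolInstance (Fin 3) (Fin 2) where
  q c := c.val
  acc s c := s = 0 ∨ c = 1
  sPref s c c' := s = 0 ∧ c < c'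
  cPref c s s' := c = 1 ∧ s < s'
  sPref_irrefl := by decide
  sPref_trans := by decide
  sPref_total := by decide
  sPref_acc := by decide
  cPref_irrefl := by decide
  cPref_trans := by decide
  cPref_total := by decide
  cPref_acc := by decide

theorem ncard_assignedSet {S C : Type*} [Fintype S] [DecidableEq C] (μ : S → Option C) (c : C) :
    (assignedSet μ c).ncard = (Finset.univ.filter fun s => μ s = some c).card := by
  rw [← Set.ncard_coe_finset]
  simp [assignedSet]

theorem competition_prefOver_iff (s : Fin 3) (c : Fin 2) (o : Option (Fin 2)) :
    competition.prefOver s c o ↔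
      o.elim (s = 0 ∨ c = 1 : Bool) (fun c' => (s = 0 ∧ c < c' : Bool)) = true := by
  cases o <;> simp [prefOver, competition]

/-- Stability in an expansion of `competition`, in a form that can be decided. -/
theorem competition_expand_isStable_iff (t : Fin 2 → ℕ) (μ : Fin 3 → Option (Fin 2)) :
    (competition.expand t).IsStable μ ↔
      ((∀ s c, μ s = some c → s = 0 ∨ c = 1) ∧
        ∀ c, (Finset.univ.filter fun s => μ s = some c).card ≤ c.val + t c) ∧
      ∀ s c, ¬ ((s = 0 ∨ c = 1) ∧
        (μ s).elim (s = 0 ∨ c = 1 : Bool) (fun c' => (s = 0 ∧ c < c' : Bool)) = true ∧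
        ((Finset.univ.filter fun s => μ s = some c).card < c.val + t c ∨
          ∃ s', μ s' = some c ∧ c = 1 ∧ s < s')) := by
  simp only [← competition_prefOver_iff, ← ncard_assignedSet]
  rfl

theorem competition_rank_of_ne_zero {s : Fin 3} (hs : s ≠ 0) (c : Fin 2) :
    competition.rank s c = 1 := by
  simp [rank, competition, hs]

theorem isLeast_objValSet_of_isStable_iff {S C : Type*} [Fintype S] [Fintype C]
    {i : SchoolInstance S C} {t : C → ℕ} {μ : S → Option C}
    (h : ∀ μ', (i.expand t).IsStable μ' ↔ μ' = μ) (rpen : S → ℝ) :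
    IsLeast (i.objValSet rpen t) (i.ceObjP rpen μ) := by
  simp [objValSet, h]

theorem competition_isStable_iff_both (μ : Fin 3 → Option (Fin 2)) :
    (competition.expand fun c => max (![1, 0] c) (![0, 1] c)).IsStable μ ↔
      μ = ![some 0, some 1, some 1] := by
  rw [competition_expand_isStable_iff]
  revert μ
  decide

theorem competition_isStable_iff_neither (μ : Fin 3 → Option (Fin 2)) :
    (competition.expand fun c => min (![1, 0] c) (![0, 1] c)).IsStable μ ↔
      μ = ![some 1, none, none] := by
  rw [competition_expand_isStable_iff]
  revert μ
  decide

theorem competition_isStable_iff_left (μ : Fin 3 → Option (Fin 2)) :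
    (competition.expand ![1, 0]).IsStable μ ↔ μ = ![some 0, some 1, none] := by
  rw [competition_expand_isStable_iff]
  revert μ
  decide

theorem competition_isStable_iff_right (μ : Fin 3 → Option (Fin 2)) :
    (competition.expand ![0, 1]).IsStable μ ↔ μ = ![some 1, some 1, none] := by
  rw [competition_expand_isStable_iff]
  revert μ
  decide

end SchoolInstance

/-- The function `f` (value of the student-optimal stable matching of
`Γ_t`) is not lattice supermodular: on some instance there are `t, t'` with
`f(t ∨ t') + f(t ∧ t') < f(t) + f(t')`. -/
theorem f_not_lattice_supermodular :
    ∃ (nS nC : ℕ) (i : SchoolInstance (Fin nS) (Fin nC)) (rpen : Fin nS → ℝ)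
      (t t' : Fin nC → ℕ) (v₁ v₂ v₃ v₄ : ℝ),
      IsLeast (SchoolInstance.objValSet i rpen (fun c => max (t c) (t' c))) v₁ ∧
      IsLeast (SchoolInstance.objValSet i rpen (fun c => min (t c) (t' c))) v₂ ∧
      IsLeast (SchoolInstance.objValSet i rpen t) v₃ ∧
      IsLeast (SchoolInstance.objValSet i rpen t') v₄ ∧
      v₁ + v₂ < v₃ + v₄ := by
  refine ⟨3, 2, competition, ![0, 2, 3], ![1, 0], ![0, 1], _, _, _, _,
    isLeast_objValSet_of_isStable_iff competition_isStable_iff_both _,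
    isLeast_objValSet_of_isStable_iff competition_isStable_iff_neither _,
    isLeast_objValSet_of_isStable_iff competition_isStable_iff_left _,
    isLeast_objValSet_of_isStable_iff competition_isStable_iff_right _, ?_⟩
  simp [ceObjP, Fin.sum_univ_three, competition_rank_of_ne_zero]
  linarith
end
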